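/- arXiv:2104.10882 — 7 statements merged into one kernel-verified Lean document; each statement's English description precedes it below -/
import Mathlib

section
/- Let F be an algebraically closed field and M a finite-dimensional F-vector space which is an internal direct sum M = M_1 ⊕ M_2 ⊕ ⋯ ⊕ M_l of nonzero subspaces, with d := dim M_1 > 1. Let x be a diagonalizable (semisimple) linear automorphism of M such that x M_l = M_1 and x M_i = M_{i+1} for 1 ≤ i ≤ l−1, and such that x^l acts on M_1 as a scalar. Then every eigenvalue of x on M has geometric multiplicity exactly d. -/
section CyclicDecomposition

open DirectSum
open scoped Fin.CommRing

variable {F M : Type*} [Field F] [AddCommGroup M] [Module F M] {l : ℕ}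
  {f : Module.End F M}

theorem pow_apply_of_mem_eigenspace {μ : F} {v : M} (hv : v ∈ f.eigenspace μ) (k : ℕ) :
    (f ^ k) v = μ ^ k • v := by
  induction k with
  | zero => simp
  | succ k ih =>
    rw [pow_succ', Module.End.mul_apply, ih, map_smul, Module.End.mem_eigenspace_iff.1 hv,
      smul_smul, pow_succ]

theorem sum_range_inv_pow_smul_mem_eigenspace {μ : F} (hμ : μ ≠ 0) {w : M}
    (hw : (f ^ l) w = μ ^ l • w) :
    ∑ k ∈ Finset.range l, (μ⁻¹) ^ k • (f ^ k) w ∈ f.eigenspace μ := by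
  have hl : (μ⁻¹) ^ l • (f ^ l) w = w := by
    rw [hw, smul_smul, ← mul_pow, inv_mul_cancel₀ hμ, one_pow, one_smul]
  have hshift : ∑ k ∈ Finset.range l, (μ⁻¹) ^ (k + 1) • (f ^ (k + 1)) w =
      ∑ k ∈ Finset.range l, (μ⁻¹) ^ k • (f ^ k) w := by
    have h := (Finset.sum_range_succ' (fun k => (μ⁻¹) ^ k • (f ^ k) w) l).symm.trans
      (Finset.sum_range_succ _ l)
    rw [hl] at h
    simpa using h
  rw [Module.End.mem_eigenspace_iff]
  conv_rhs => rw [← hshift]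
  rw [map_sum, Finset.smul_sum]
  refine Finset.sum_congr rfl fun k _ => ?_
  rw [map_smul, smul_smul, pow_succ' μ⁻¹, mul_inv_cancel_left₀ hμ, pow_succ' f,
    Module.End.mul_apply]

variable [NeZero l] {N : Fin l → Submodule F M}

theorem pow_apply_mem_of_mem_zero (hf : ∀ i, (N i).map f ≤ N (i + 1)) {w : M} (hw : w ∈ N 0)
    (k : ℕ) : (f ^ k) w ∈ N k := by
  induction k with
  | zero => simpa using hw
  | succ k ih =>
    rw [pow_succ', Module.End.mul_apply, Nat.cast_succ]
    exact hf _ (Submodule.mem_map_of_mem ih)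

variable [DirectSum.Decomposition N]

theorem decompose_apply_add_one (hf : ∀ i, (N i).map f ≤ N (i + 1)) (v : M) (i : Fin l) :
    (decompose N (f v) (i + 1) : M) = f (decompose N v i) := by
  induction v using DirectSum.Decomposition.inductionOn N with
  | zero => simp
  | @homogeneous j m =>
    have hm : f m ∈ N (j + 1) := hf j (Submodule.mem_map_of_mem m.2)
    by_cases h : j = i
    · subst h
      rw [decompose_of_mem_same N hm, decompose_of_mem_same N m.2]
    · rw [decompose_of_mem_ne N hm (by simpa using h), decompose_of_mem_ne N m.2 h, map_zero]
  | add a b ha hb => simp [ha, hb]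

theorem decompose_pow_apply_add_natCast (hf : ∀ i, (N i).map f ≤ N (i + 1)) (k : ℕ) (v : M)
    (i : Fin l) : (decompose N ((f ^ k) v) (i + k) : M) = (f ^ k) (decompose N v i) := by
  induction k with
  | zero => rw [Nat.cast_zero, add_zero, pow_zero, Module.End.one_apply, Module.End.one_apply]
  | succ k ih =>
    rw [pow_succ', Module.End.mul_apply, Nat.cast_succ, ← add_assoc,
      decompose_apply_add_one hf, ih, Module.End.mul_apply]

theorem eq_zero_of_mem_eigenspace_of_decompose_zero (hf : ∀ i, (N i).map f ≤ N (i + 1))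
    {μ : F} (hμ : μ ≠ 0) {v : M} (hv : v ∈ f.eigenspace μ) (h0 : (decompose N v 0 : M) = 0) :
    v = 0 := by
  refine (decompose N).injective ?_
  rw [decompose_zero]
  ext i
  have h := decompose_pow_apply_add_natCast hf i v 0
  rw [h0, map_zero, pow_apply_of_mem_eigenspace hv, zero_add, Fin.cast_val_eq_self,
    decompose_smul, DirectSum.smul_apply] at h
  simpa [hμ] using h

theorem pow_eq_of_hasEigenvalue (hf : ∀ i, (N i).map f ≤ N (i + 1)) {c μ : F} (hμ : μ ≠ 0)
    (hc : ∀ v ∈ N 0, (f ^ l) v = c • v) (h : f.HasEigenvalue μ) : μ ^ l = c := by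
  obtain ⟨v, hv, hv0⟩ := h.exists_hasEigenvector
  have hne : (decompose N v 0 : M) ≠ 0 := fun h0 =>
    hv0 (eq_zero_of_mem_eigenspace_of_decompose_zero hf hμ hv h0)
  have h := decompose_pow_apply_add_natCast hf l v 0
  rw [hc _ (decompose N v 0).2, pow_apply_of_mem_eigenspace hv, zero_add, Fin.natCast_self,
    decompose_smul] at h
  exact smul_left_injective F hne h

theorem decompose_sum_range_pow_zero (hf : ∀ i, (N i).map f ≤ N (i + 1)) (a : F) {w : M}
    (hw : w ∈ N 0) :
    (decompose N (∑ k ∈ Finset.range l, a ^ k • (f ^ k) w) 0 : M) = w := by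
  rw [decompose_sum, DFinsupp.finsetSum_apply, Submodule.coe_sum, Finset.sum_eq_single 0]
  · simpa using decompose_of_mem_same N hw
  · intro k hk hk0
    refine decompose_of_mem_ne N (Submodule.smul_mem _ _ (pow_apply_mem_of_mem_zero hf hw k)) ?_
    rw [Ne, Fin.natCast_eq_zero]
    exact fun h => hk0 (Nat.eq_zero_of_dvd_of_lt h (Finset.mem_range.1 hk))
  · simp [NeZero.ne l]

/-- If `f` permutes the summands of `M` cyclically and `f ^ l` is a scalar on the zeroth summand,
then projecting to that summand identifies it with each eigenspace of `f` for a nonzero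
eigenvalue. -/
theorem finrank_eigenspace_eq_finrank_zero (hf : ∀ i, (N i).map f ≤ N (i + 1)) {c μ : F}
    (hμ : μ ≠ 0) (hc : ∀ v ∈ N 0, (f ^ l) v = c • v) (h : f.HasEigenvalue μ) :
    Module.finrank F (f.eigenspace μ) = Module.finrank F (N 0) := by
  obtain rfl := pow_eq_of_hasEigenvalue hf hμ hc h
  let p : f.eigenspace μ →ₗ[F] N 0 :=
    DirectSum.component F (Fin l) (fun i => N i) 0 ∘ₗ
      (decomposeLinearEquiv N).toLinearMap ∘ₗ (f.eigenspace μ).subtype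
  refine (LinearEquiv.ofBijective p ⟨?_, ?_⟩).finrank_eq
  · rw [injective_iff_map_eq_zero]
    intro v hv
    exact Subtype.ext (eq_zero_of_mem_eigenspace_of_decompose_zero hf hμ v.2
      (congrArg Subtype.val hv))
  · intro w
    exact ⟨⟨_, sum_range_inv_pow_smul_mem_eigenspace hμ (hc w w.2)⟩,
      Subtype.ext (decompose_sum_range_pow_zero hf μ⁻¹ w.2)⟩

end CyclicDecomposition

/-- Lemma: if `M = M₁ ⊕ ⋯ ⊕ M_l` with `d = dim M₁ > 1`, and a diagonalizable automorphism
`x` cyclically permutes the summands (`x Mᵢ = M_{i+1}` indices mod `l`) and `x^l` acts as a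
scalar on `M₁`, then every eigenvalue of `x` has geometric multiplicity exactly `d`. -/
theorem stmt_1 (F : Type*) [Field F] [IsAlgClosed F] (M : Type*) [AddCommGroup M] [Module F M]
    [FiniteDimensional F M] (l : ℕ) [NeZero l] (Msub : Fin l → Submodule F M)
    (hInternal : DirectSum.IsInternal Msub) (hne : ∀ i, Msub i ≠ ⊥)
    (d : ℕ) (hd : d = Module.finrank F (Msub 0)) (hd1 : 1 < d)
    (x : M ≃ₗ[F] M)
    (hdiag : (⨆ μ : F, Module.End.eigenspace (x : Module.End F M) μ) = ⊤)
    (hcycle : ∀ i : Fin l, (Msub i).map (x : M →ₗ[F] M) = Msub (i + 1))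
    (hscalar : ∃ c : F, ∀ v ∈ Msub 0, (x ^ l) v = c • v)
    (μ : F) (hμ : Module.End.HasEigenvalue (x : Module.End F M) μ) :
    Module.finrank F (Module.End.eigenspace (x : Module.End F M) μ) = d := by
  subst hd
  obtain ⟨c, hc⟩ := hscalar
  let _ : DirectSum.Decomposition Msub := hInternal.chooseDecomposition
  have hμ0 : μ ≠ 0 := by
    rintro rfl
    obtain ⟨v, hv, hv0⟩ := hμ.exists_hasEigenvector
    rw [Module.End.mem_eigenspace_iff, zero_smul] at hv
    exact hv0 (x.map_eq_zero_iff.1 hv)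
  have hpow (k : ℕ) (v : M) : ((x : Module.End F M) ^ k) v = (x ^ k) v := by
    induction k with
    | zero => rfl
    | succ k ih =>
      rw [pow_succ', pow_succ', Module.End.mul_apply, ih]
      rfl
  exact finrank_eigenspace_eq_finrank_zero (fun i => (hcycle i).le) hμ0
    (fun v hv => (hpow l v).trans (hc v hv)) hμ
end

section
/- Let F be an algebraically closed field, H a group, G a normal subgroup of H such that the quotient H/G is cyclic of prime order k, and (ρ, V) a finite-dimensional irreducible F-linear representation of H whose restriction to G is not irreducible. Let h ∈ H \ G and assume ρ(h) is diagonalizable. Then ρ(h) has simple spectrum on V if and only if for every irreducible G-submodule W of V, the restriction of ρ(h^k) to W has simple spectrum (note h^k ∈ G, so W is invariant under ρ(h^k)). -/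
/-- A diagonalizable endomorphism has *simple spectrum* if it is diagonalizable and every
eigenvalue has (geometric) multiplicity 1. -/
def HasSimpleSpectrum {F V : Type*} [Field F] [AddCommGroup V] [Module F V]
    (f : Module.End F V) : Prop :=
  (⨆ μ : F, f.eigenspace μ) = ⊤ ∧ ∀ μ : F, Module.finrank F (f.eigenspace μ) ≤ 1

section Auxiliary

open Module

/-- A submodule that is simple among the submodules stable under a set `S` of endomorphisms and
is contained in a sum of such submodules is `S`-equivariantly isomorphic to a summand. -/
theorem exists_equivariant_equiv_of_le_iSup {F V ι : Type*} [Field F] [AddCommGroup V] [Module F V]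
    (S : Set (End F V)) (W : Submodule F V) (U : ι → Submodule F V)
    (hW : ∀ s ∈ S, ∀ v ∈ W, s v ∈ W) (hW0 : W ≠ ⊥)
    (hWs : ∀ X ≤ W, (∀ s ∈ S, ∀ v ∈ X, s v ∈ X) → X = ⊥ ∨ X = W)
    (hU : ∀ i, ∀ s ∈ S, ∀ v ∈ U i, s v ∈ U i) (hU0 : ∀ i, U i ≠ ⊥)
    (hUs : ∀ i, ∀ X ≤ U i, (∀ s ∈ S, ∀ v ∈ X, s v ∈ X) → X = ⊥ ∨ X = U i)
    (hle : W ≤ ⨆ i, U i) :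
    ∃ i, ∃ e : W ≃ₗ[F] U i, ∀ s ∈ S, ∀ w w' : W, (w' : V) = s w → (e w' : V) = s (e w) := by
  let R := Algebra.adjoin F S
  have stable (X : Submodule F V) (hX : ∀ s ∈ S, ∀ v ∈ X, s v ∈ X) (r : R) :
      ∀ v ∈ X, r • v ∈ X := by
    obtain ⟨r, hr⟩ := r
    change ∀ v ∈ X, r v ∈ X
    induction hr using Algebra.adjoin_induction with
    | mem s hs => exact hX s hs
    | algebraMap a => exact fun v hv => X.smul_mem a hv
    | add a b _ _ ha hb => exact fun v hv => X.add_mem (ha v hv) (hb v hv)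
    | mul a b _ _ ha hb => exact fun v hv => ha _ (hb v hv)
  let lift (X : Submodule F V) (hX : ∀ s ∈ S, ∀ v ∈ X, s v ∈ X) : Submodule R V :=
    { X with smul_mem' := fun r v hv => stable X hX r v hv }
  have lift_simple (X : Submodule F V) (hX : ∀ s ∈ S, ∀ v ∈ X, s v ∈ X) (hX0 : X ≠ ⊥)
      (hXs : ∀ Y ≤ X, (∀ s ∈ S, ∀ v ∈ Y, s v ∈ Y) → Y = ⊥ ∨ Y = X) :
      IsSimpleModule R (lift X hX) := by
    rw [isSimpleModule_iff_isAtom]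
    refine ⟨fun hbot => hX0 ?_, fun Y hY => ?_⟩
    · rw [Submodule.eq_bot_iff]
      intro v hv
      have hv' : v ∈ lift X hX := hv
      rwa [hbot, Submodule.mem_bot] at hv'
    · rcases hXs (Y.restrictScalars F) (fun v hv => hY.le hv)
        (fun s hs v hv => Y.smul_mem (⟨s, Algebra.subset_adjoin hs⟩ : R) hv) with h | h
      · exact (Submodule.restrictScalars_eq_bot_iff ..).mp h
      · refine absurd (fun v hv => ?_) hY.not_ge
        have hv' : v ∈ X := hv
        rwa [← h] at hv'
  have simpleW := lift_simple W hW hW0 hWs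
  have simpleU : ∀ m : Set.range (fun i => lift (U i) (hU i)), IsSimpleModule R m := by
    rintro ⟨_, i, rfl⟩
    exact lift_simple (U i) (hU i) (hU0 i) (hUs i)
  have hle' : lift W hW ≤ sSup (Set.range fun i => lift (U i) (hU i)) := by
    have : W ≤ (sSup (Set.range fun i => lift (U i) (hU i))).restrictScalars F := by
      refine hle.trans (iSup_le fun i v hv => ?_)
      exact (le_sSup (Set.mem_range_self i) : lift (U i) (hU i) ≤ _) hv
    exact this
  obtain ⟨_, ⟨i, rfl⟩, ⟨e⟩⟩ := Submodule.linearEquiv_of_le_sSup _ _ hle'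
  refine ⟨i, e.restrictScalars F, fun s hs w w' hw => ?_⟩
  have := congrArg Subtype.val (e.map_smul (⟨s, Algebra.subset_adjoin hs⟩ : R) w)
  have hw' : w' = (⟨s, Algebra.subset_adjoin hs⟩ : R) • (show lift W hW from w) := Subtype.ext hw
  rw [hw']
  exact this

theorem eigenspace_le_eigenspace_pow {F V : Type*} [Field F] [AddCommGroup V] [Module F V]
    (f : End F V) (μ : F) (n : ℕ) : f.eigenspace μ ≤ (f ^ n).eigenspace (μ ^ n) := by
  intro v hv
  rw [End.mem_eigenspace_iff] at hv ⊢
  induction n with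
  | zero => simp
  | succ n ih => rw [pow_succ, End.mul_apply, hv, map_smul, ih, smul_smul, ← pow_succ']

section Representation

variable {F H V : Type*} [Field F] [Group H] [AddCommGroup V] [Module F V]
  (G : Subgroup H) (ρ : Representation F H V)

theorem finrank_eigenspace_le_finrank_eigenspace_pow_restrict [FiniteDimensional F V]
    {k : ℕ} {h : H} (hgen : ∀ x : H, ∃ g ∈ G, ∃ n : ℕ, x = g * h ^ n) (hhk : h ^ k ∈ G)
    (hirr : ∀ W : Submodule F V, W ≠ ⊥ → (∀ g : H, ∀ v ∈ W, ρ g v ∈ W) → W = ⊤)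
    {W W' : Submodule F V} (hW0 : W ≠ ⊥) (hW' : ∀ g ∈ G, ∀ v ∈ W', ρ g v ∈ W')
    (hcompl : IsCompl W W') (hWk : ∀ v ∈ W, ρ (h ^ k) v ∈ W) (μ : F) :
    finrank F (End.eigenspace (ρ h) μ) ≤
      finrank F (End.eigenspace ((ρ (h ^ k)).restrict hWk) (μ ^ k)) := by
  let π := W.projectionOnto W' hcompl
  have hπ : ∀ v ∈ End.eigenspace (ρ h) μ,
      π v ∈ End.eigenspace ((ρ (h ^ k)).restrict hWk) (μ ^ k) := by
    intro v hv
    have hpow : ρ (h ^ k) v = μ ^ k • v := by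
      rw [map_pow]
      exact End.mem_eigenspace_iff.mp (eigenspace_le_eigenspace_pow (ρ h) μ k hv)
    have hsub : v - π v ∈ W' := by
      rw [← Submodule.projectionOnto_apply_eq_zero_iff hcompl, map_sub,
        Submodule.projectionOnto_apply_left, sub_self]
    have hcomm : π (ρ (h ^ k) v) = ⟨ρ (h ^ k) (π v), hWk _ (π v).2⟩ := by
      have h0 : π (ρ (h ^ k) (v - π v)) = 0 :=
        (Submodule.projectionOnto_apply_eq_zero_iff hcompl).mpr (hW' _ hhk _ hsub)
      rw [map_sub, map_sub, sub_eq_zero] at h0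
      rw [h0]
      exact Submodule.projectionOnto_apply_of_mem_left hcompl (hWk _ (π v).2)
    rw [End.mem_eigenspace_iff, ← map_smul, ← hpow, hcomm]
    rfl
  let f := π.restrict hπ
  refine LinearMap.finrank_le_finrank_of_injective (f := f) ?_
  rw [← LinearMap.ker_eq_bot, LinearMap.ker_eq_bot']
  rintro ⟨v, hv⟩ hfv
  have hvW' : v ∈ W' := by
    have : π v = 0 := congrArg Subtype.val hfv
    exact (Submodule.projectionOnto_apply_eq_zero_iff hcompl).mp this
  let X : Submodule F V := ⨅ x : H, W'.comap (ρ x)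
  have hX (u : V) : u ∈ X ↔ ∀ x : H, ρ x u ∈ W' := by simp [X]
  have hvX : v ∈ X := by
    rw [hX]
    intro x
    obtain ⟨g, hg, n, rfl⟩ := hgen x
    have hn := eigenspace_le_eigenspace_pow (ρ h) μ n hv
    rw [End.mem_eigenspace_iff] at hn
    rw [map_mul, map_pow, End.mul_apply, hn, map_smul]
    exact W'.smul_mem _ (hW' g hg v hvW')
  have hXbot : X = ⊥ := by
    by_contra hX0
    have hXtop := hirr X hX0 fun g u hu => by
      rw [hX] at hu ⊢
      intro x
      simpa using hu (x * g)
    have hW'top : W' = ⊤ := by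
      rw [eq_top_iff, ← hXtop]
      intro u hu
      simpa using (hX u).mp hu 1
    rw [hW'top] at hcompl
    exact hW0 (disjoint_top.mp hcompl.disjoint)
  rw [hXbot, Submodule.mem_bot] at hvX
  exact Subtype.ext hvX

theorem finrank_eigenspace_pow_restrict_le_finrank_eigenspace [FiniteDimensional F V]
    {k : ℕ} (hk : 0 < k) {h : H} {W W' : Submodule F V} (hdisj : Disjoint W W')
    (hW' : ∀ i, i ≠ 0 → i < k → W.map (ρ (h ^ i)) ≤ W')
    (hWk : ∀ v ∈ W, ρ (h ^ k) v ∈ W) {μ : F} (hμ : μ ≠ 0) :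
    finrank F (End.eigenspace ((ρ (h ^ k)).restrict hWk) (μ ^ k)) ≤
      finrank F (End.eigenspace (ρ h) μ) := by
  let S : End F V := μ⁻¹ • ρ h
  let φ : End F V := ∑ i ∈ Finset.range k, S ^ i
  have hS (i : ℕ) (v : V) : (S ^ i) v = (μ⁻¹) ^ i • ρ (h ^ i) v := by
    simp [S, smul_pow]
  have hφ (w : End.eigenspace ((ρ (h ^ k)).restrict hWk) (μ ^ k)) :
      φ (w : W) ∈ End.eigenspace (ρ h) μ := by
    have hw : ρ (h ^ k) (w : W) = μ ^ k • ((w : W) : V) :=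
      congrArg Subtype.val (End.mem_eigenspace_iff.mp w.2)
    have h1 : (S ^ k) (w : W) = ((w : W) : V) := by
      rw [hS, hw, smul_smul, ← mul_pow, inv_mul_cancel₀ hμ, one_pow, one_smul]
    have h2 := LinearMap.congr_fun (mul_geom_sum S k) ((w : W) : V)
    simp only [End.mul_apply, LinearMap.sub_apply, h1, End.one_apply, sub_self] at h2
    rw [End.mem_eigenspace_iff]
    have h3 : μ⁻¹ • ρ h (φ (w : W)) = φ (w : W) := sub_eq_zero.mp h2
    rw [inv_smul_eq_iff₀ hμ] at h3
    exact h3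
  let f : End.eigenspace ((ρ (h ^ k)).restrict hWk) (μ ^ k) →ₗ[F] End.eigenspace (ρ h) μ :=
    (φ ∘ₗ W.subtype ∘ₗ Submodule.subtype _).codRestrict _ hφ
  refine LinearMap.finrank_le_finrank_of_injective (f := f) ?_
  rw [← LinearMap.ker_eq_bot, LinearMap.ker_eq_bot']
  intro w hw
  have hw0 : φ (w : W) = 0 := congrArg Subtype.val hw
  obtain ⟨m, rfl⟩ := Nat.exists_eq_succ_of_ne_zero hk.ne'
  simp only [φ, Finset.sum_range_succ', pow_zero, LinearMap.add_apply, LinearMap.sum_apply,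
    End.one_apply] at hw0
  have hmem : ((w : W) : V) ∈ W' := by
    rw [eq_neg_of_add_eq_zero_right hw0]
    refine W'.neg_mem (W'.sum_mem fun i hi => ?_)
    rw [hS]
    exact W'.smul_mem _ (hW' (i + 1) (by omega) (by have := Finset.mem_range.mp hi; omega)
      ⟨_, (w : W).2, rfl⟩)
  exact Subtype.ext (Subtype.ext (Submodule.disjoint_def.mp hdisj _ (w : W).2 hmem))

theorem exists_minimal_invariant_submodule [FiniteDimensional F V] [Nontrivial V] :
    ∃ W : Submodule F V, W ≠ ⊥ ∧ (∀ g ∈ G, ∀ v ∈ W, ρ g v ∈ W) ∧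
      ∀ U : Submodule F V, U ≤ W → (∀ g ∈ G, ∀ v ∈ U, ρ g v ∈ U) → U = ⊥ ∨ U = W := by
  obtain ⟨W, ⟨hW0, hW⟩, hmin⟩ := wellFounded_lt.has_min
    {W : Submodule F V | W ≠ ⊥ ∧ ∀ g ∈ G, ∀ v ∈ W, ρ g v ∈ W}
    ⟨⊤, top_ne_bot, fun _ _ _ _ => Submodule.mem_top⟩
  refine ⟨W, hW0, hW, fun U hU hUG => or_iff_not_imp_left.mpr fun hU0 => ?_⟩
  exact hU.eq_of_not_lt (hmin U ⟨hU0, hUG⟩)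

variable [G.Normal]

theorem exists_mem_mul_pow_of_prime_card_quotient {k : ℕ} (hk : k.Prime)
    (hcard : Nat.card (H ⧸ G) = k) {h : H} (hh : h ∉ G) (x : H) :
    ∃ g ∈ G, ∃ n : ℕ, x = g * h ^ n := by
  have := Fact.mk hk
  have h1 : (h : H ⧸ G) ≠ 1 := by rwa [Ne, QuotientGroup.eq_one_iff]
  obtain ⟨n, hn⟩ := mem_powers_of_prime_card (g' := (x : H ⧸ G)) hcard h1
  refine ⟨x * (h ^ n)⁻¹, ?_, n, by simp⟩
  rw [← QuotientGroup.eq_one_iff]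
  simp only [QuotientGroup.mk_mul, QuotientGroup.mk_inv, QuotientGroup.mk_pow]
  rw [← hn]
  simp

theorem pow_mem_of_prime_card_quotient {k : ℕ} (hcard : Nat.card (H ⧸ G) = k) (h : H) :
    h ^ k ∈ G := by
  rw [← QuotientGroup.eq_one_iff, QuotientGroup.mk_pow, ← hcard, pow_card_eq_one']

theorem pow_notMem_of_prime_card_quotient {k : ℕ} (hk : k.Prime)
    (hcard : Nat.card (H ⧸ G) = k) {h : H} (hh : h ∉ G) {i : ℕ} (hi0 : i ≠ 0) (hi : i < k) :
    h ^ i ∉ G := by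
  rw [← QuotientGroup.eq_one_iff, QuotientGroup.mk_pow, ← orderOf_dvd_iff_pow_eq_one]
  rw [← QuotientGroup.eq_one_iff] at hh
  have := Fact.mk hk
  have hk1 : (h : H ⧸ G) ^ k = 1 := by rw [← hcard, pow_card_eq_one']
  rw [orderOf_eq_prime hk1 hh]
  exact Nat.not_dvd_of_pos_of_lt (Nat.pos_of_ne_zero hi0) hi

theorem Representation.map_apply_mem_of_normal {x : H} {W : Submodule F V}
    (hW : ∀ g ∈ G, ∀ v ∈ W, ρ g v ∈ W) :
    ∀ g ∈ G, ∀ v ∈ W.map (ρ x), ρ g v ∈ W.map (ρ x) := by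
  rintro g hg _ ⟨w, hw, rfl⟩
  refine ⟨ρ (x⁻¹ * g * x) w, hW _ ?_ w hw, ?_⟩
  · simpa using Subgroup.Normal.conj_mem ‹G.Normal› g hg x⁻¹
  · simp only [← End.mul_apply, ← map_mul]
    congr 2
    group

/-- If `H` is generated by `G` and `h`, a proper `G`-submodule of an irreducible representation
of `H` is not isomorphic to its `h`-translate. -/
theorem eq_top_of_equivariant_equiv_map [IsAlgClosed F] [FiniteDimensional F V]
    {h : H} (hgen : ∀ x : H, ∃ g ∈ G, ∃ n : ℕ, x = g * h ^ n)
    (hirr : ∀ W : Submodule F V, W ≠ ⊥ → (∀ g : H, ∀ v ∈ W, ρ g v ∈ W) → W = ⊤)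
    {W : Submodule F V} (hW0 : W ≠ ⊥) (hW : ∀ g ∈ G, ∀ v ∈ W, ρ g v ∈ W)
    (e : W ≃ₗ[F] W.map (ρ h))
    (he : ∀ g ∈ G, ∀ w w' : W, (w' : V) = ρ g w → (e w' : V) = ρ g (e w)) : W = ⊤ := by
  have hinv (x : H) (v : V) : ρ x⁻¹ (ρ x v) = v := by simp
  have hmem (w : W) : ρ h⁻¹ (e w) ∈ W := by
    obtain ⟨v, hv, hv'⟩ := (e w).2
    rw [← hv', hinv]
    exact hv
  let σ : W →ₗ[F] W := ((ρ h⁻¹).comp ((W.map (ρ h)).subtype.comp e.toLinearMap)).codRestrict W hmem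
  have hσ (w : W) : (σ w : V) = ρ h⁻¹ (e w) := rfl
  have σ_surj : Function.Surjective σ := by
    intro w
    obtain ⟨w', hw'⟩ := e.surjective ⟨ρ h w, w, w.2, rfl⟩
    refine ⟨w', Subtype.ext ?_⟩
    rw [hσ, hw', hinv]
  let M : Submodule F (W →ₗ[F] V) :=
    { carrier := {f | ∀ g ∈ G, ∀ w w' : W, (w' : V) = ρ g w → f w' = ρ g (f w)}
      add_mem' := fun {a b} ha hb g hg w w' hw => by simp [ha g hg w w' hw, hb g hg w w' hw]
      zero_mem' := fun g hg w w' hw => by simp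
      smul_mem' := fun c f hf g hg w w' hw => by simp [hf g hg w w' hw] }
  have : Nontrivial M := by
    refine (Submodule.nontrivial_iff_ne_bot).mpr fun hM => hW0 ?_
    have h1 : W.subtype ∈ M := fun g hg w w' hw => hw
    rw [hM, Submodule.mem_bot] at h1
    rw [← W.range_subtype, h1, LinearMap.range_zero]
  let A₀ : (W →ₗ[F] V) →ₗ[F] (W →ₗ[F] V) :=
    { toFun := fun f => (ρ h).comp (f.comp σ)
      map_add' := fun a b => by ext; simp
      map_smul' := fun c a => by ext; simp }
  have hA₀ (f) (w : W) : A₀ f w = ρ h (f (σ w)) := rfl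
  have hA : ∀ f ∈ M, A₀ f ∈ M := by
    intro f hf g hg w w' hw
    have hconj : h⁻¹ * g * h ∈ G := by
      simpa using Subgroup.Normal.conj_mem ‹G.Normal› g hg h⁻¹
    rw [hA₀, hA₀, hf (h⁻¹ * g * h) hconj (σ w) (σ w')]
    · simp only [← End.mul_apply, ← map_mul]
      congr 2
      group
    · rw [hσ, hσ, he g hg w w' hw]
      simp only [← End.mul_apply, ← map_mul]
      congr 2
      group
  obtain ⟨μ, hμ⟩ := End.exists_eigenvalue (A₀.restrict hA)
  obtain ⟨⟨f, hfM⟩, hf, hf0⟩ := hμ.exists_hasEigenvector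
  rw [End.mem_eigenspace_iff] at hf
  have hf' (w : W) : ρ h (f (σ w)) = μ • f w :=
    LinearMap.congr_fun (congrArg Subtype.val hf) w
  have hf0' : f ≠ 0 := fun h0 => hf0 (Subtype.ext h0)
  have hGr : ∀ g ∈ G, ∀ v ∈ LinearMap.range f, ρ g v ∈ LinearMap.range f := by
    rintro g hg _ ⟨w, rfl⟩
    exact ⟨⟨ρ g w, hW g hg w w.2⟩, hfM g hg w _ rfl⟩
  have hhr : ∀ v ∈ LinearMap.range f, ρ h v ∈ LinearMap.range f := by
    rintro _ ⟨w, rfl⟩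
    obtain ⟨w, rfl⟩ := σ_surj w
    exact ⟨μ • w, by rw [hf', map_smul]⟩
  have hrange : LinearMap.range f = ⊤ := by
    refine hirr _ (fun h0 => hf0' (LinearMap.range_eq_bot.mp h0)) fun x v hv => ?_
    obtain ⟨g, hg, n, rfl⟩ := hgen x
    rw [map_mul, End.mul_apply]
    refine hGr g hg _ ?_
    rw [map_pow]
    induction n with
    | zero => simpa using hv
    | succ n ih => rw [pow_succ', End.mul_apply]; exact hhr _ ih
  refine Submodule.eq_top_of_finrank_eq (le_antisymm W.finrank_le ?_)
  rw [← finrank_top F V, ← hrange]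
  exact f.finrank_range_le

theorem mem_iSup_map_notMem_of_mem {W : Submodule F V} (hW : ∀ g ∈ G, ∀ v ∈ W, ρ g v ∈ W) :
    ∀ g ∈ G, ∀ v ∈ ⨆ x : {x : H // x ∉ G}, W.map (ρ x),
      ρ g v ∈ ⨆ x : {x : H // x ∉ G}, W.map (ρ x) := by
  intro g hg
  change _ ≤ Submodule.comap (ρ g) (⨆ x : {x : H // x ∉ G}, W.map (ρ x))
  exact iSup_le fun x v hv => (le_iSup (fun x : {x : H // x ∉ G} => W.map (ρ x)) x)
    (ρ.map_apply_mem_of_normal G hW g hg v hv)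

/-- An irreducible `G`-submodule of an irreducible representation of `H`, with `H ⧸ G` of prime
order, is complemented by the sum of its translates by elements outside `G`. -/
theorem isCompl_iSup_map_notMem [IsAlgClosed F] [FiniteDimensional F V]
    {k : ℕ} (hk : k.Prime) (hcard : Nat.card (H ⧸ G) = k)
    (hirr : ∀ W : Submodule F V, W ≠ ⊥ → (∀ g : H, ∀ v ∈ W, ρ g v ∈ W) → W = ⊤)
    {W : Submodule F V} (hW0 : W ≠ ⊥) (hW1 : W ≠ ⊤)
    (hW : ∀ g ∈ G, ∀ v ∈ W, ρ g v ∈ W)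
    (hWs : ∀ U : Submodule F V, U ≤ W → (∀ g ∈ G, ∀ v ∈ U, ρ g v ∈ U) → U = ⊥ ∨ U = W) :
    IsCompl W (⨆ x : {x : H // x ∉ G}, W.map (ρ x)) := by
  have hmapmap (x y : H) (U : Submodule F V) : (U.map (ρ x)).map (ρ y) = U.map (ρ (y * x)) := by
    rw [map_mul, End.mul_eq_comp, Submodule.map_comp]
  have hmapone (U : Submodule F V) : U.map (ρ 1) = U := by
    rw [map_one, End.one_eq_id, Submodule.map_id]
  constructor
  · by_contra hdisj
    rw [disjoint_iff] at hdisj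
    have hle : W ≤ ⨆ x : {x : H // x ∉ G}, W.map (ρ x) :=
      inf_eq_left.mp ((hWs _ inf_le_left fun g hg v hv =>
        ⟨hW g hg v hv.1, mem_iSup_map_notMem_of_mem G ρ hW g hg v hv.2⟩).resolve_left hdisj)
    obtain ⟨x, e, he⟩ := exists_equivariant_equiv_of_le_iSup (ρ '' G) W
      (fun x : {x : H // x ∉ G} => W.map (ρ x))
      (by simpa using hW) hW0 (by simpa using hWs)
      (fun x => by
        rintro _ ⟨g, hg, rfl⟩
        exact ρ.map_apply_mem_of_normal G hW g hg)
      (fun x h0 => hW0 <| by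
        rw [← hmapone W, ← inv_mul_cancel x.1, ← hmapmap, h0, Submodule.map_bot])
      (fun x X hX hXG => by
        have hXG' : ∀ g ∈ G, ∀ v ∈ X, ρ g v ∈ X := fun g hg => hXG _ ⟨g, hg, rfl⟩
        have hXx : X = (X.map (ρ x.1⁻¹)).map (ρ x) := by rw [hmapmap, mul_inv_cancel, hmapone]
        rcases hWs (X.map (ρ x.1⁻¹))
          (by
            refine (Submodule.map_mono hX).trans ?_
            rw [hmapmap, inv_mul_cancel, hmapone])
          (ρ.map_apply_mem_of_normal G hXG') with h0 | h0
        · left; rw [hXx, h0, Submodule.map_bot]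
        · right; rw [hXx, h0])
      hle
    exact hW1 (eq_top_of_equivariant_equiv_map G ρ
      (exists_mem_mul_pow_of_prime_card_quotient G hk hcard x.2) hirr hW0 hW e
      fun g hg => he _ ⟨g, hg, rfl⟩)
  · rw [codisjoint_iff]
    refine hirr _ (fun h0 => hW0 (eq_bot_iff.mpr (h0 ▸ le_sup_left))) fun y => ?_
    have hall (x : H) : W.map (ρ x) ≤ W ⊔ ⨆ x : {x : H // x ∉ G}, W.map (ρ x) := by
      by_cases hx : x ∈ G
      · exact le_sup_of_le_left (Submodule.map_le_iff_le_comap.mpr (hW x hx))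
      · exact le_sup_of_le_right
          (le_iSup (fun x : {x : H // x ∉ G} => W.map (ρ x)) ⟨x, hx⟩)
    change _ ≤ Submodule.comap (ρ y) (W ⊔ ⨆ x : {x : H // x ∉ G}, W.map (ρ x))
    rw [← Submodule.map_le_iff_le_comap, Submodule.map_sup, Submodule.map_iSup]
    refine sup_le (hall y) (iSup_le fun x => ?_)
    rw [hmapmap]
    exact hall _

end Representation

end Auxiliary

/-- Let `G ⊴ H` with `H/G` cyclic of prime order `k`, `ρ` a finite-dimensional irreducible
representation of `H` over an algebraically closed field whose restriction to `G` is not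
irreducible, and `h ∈ H \ G` with `ρ h` diagonalizable.  Then `ρ h` has simple spectrum
iff `ρ (h^k)` has simple spectrum on every irreducible `G`-submodule of `V`. -/
theorem stmt_2 (F : Type*) [Field F] [IsAlgClosed F] (H : Type*) [Group H]
    (V : Type*) [AddCommGroup V] [Module F V] [FiniteDimensional F V] [Nontrivial V]
    (G : Subgroup H) [G.Normal] (k : ℕ) (hk : k.Prime) (hcard : Nat.card (H ⧸ G) = k)
    (ρ : Representation F H V)
    (hirr : ∀ W : Submodule F V, W ≠ ⊥ → (∀ g : H, ∀ v ∈ W, ρ g v ∈ W) → W = ⊤)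
    (hred : ¬ (∀ W : Submodule F V, W ≠ ⊥ → (∀ g ∈ G, ∀ v ∈ W, ρ g v ∈ W) → W = ⊤))
    (h : H) (hh : h ∉ G)
    (hdiag : (⨆ μ : F, Module.End.eigenspace (ρ h) μ) = ⊤) :
    HasSimpleSpectrum (ρ h) ↔
      ∀ W : Submodule F V, W ≠ ⊥ → (∀ g ∈ G, ∀ v ∈ W, ρ g v ∈ W) →
        (∀ U : Submodule F V, U ≤ W → (∀ g ∈ G, ∀ v ∈ U, ρ g v ∈ U) → U = ⊥ ∨ U = W) →
        ∀ hWk : ∀ v ∈ W, ρ (h ^ k) v ∈ W,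
          HasSimpleSpectrum ((ρ (h ^ k)).restrict hWk) := by
  have hgen := exists_mem_mul_pow_of_prime_card_quotient G hk hcard hh
  have hhk := pow_mem_of_prime_card_quotient G hcard h
  have hproper (W : Submodule F V)
      (hWs : ∀ U : Submodule F V, U ≤ W → (∀ g ∈ G, ∀ v ∈ U, ρ g v ∈ U) → U = ⊥ ∨ U = W) :
      W ≠ ⊤ := by
    rintro rfl
    exact hred fun U hU0 hU => (hWs U le_top hU).resolve_left hU0
  constructor
  · intro hsimple W hW0 hW hWs hWk
    have hcompl := isCompl_iSup_map_notMem G ρ hk hcard hirr hW0 (hproper W hWs) hW hWs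
    refine ⟨Module.End.genEigenspace_restrict_eq_top hWk ?_, fun c => ?_⟩
    · rw [eq_top_iff, ← hdiag]
      refine iSup_le fun μ => le_iSup_of_le (μ ^ k) ?_
      rw [map_pow]
      exact eigenspace_le_eigenspace_pow _ _ _
    · obtain ⟨μ, rfl⟩ := IsAlgClosed.exists_pow_nat_eq c hk.pos
      rcases eq_or_ne μ 0 with rfl | hμ
      · have : Module.End.eigenspace ((ρ (h ^ k)).restrict hWk) (0 ^ k) = ⊥ := by
          rw [zero_pow hk.ne_zero, Module.End.eigenspace_zero, LinearMap.ker_eq_bot']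
          intro w hw
          have hw' : ρ (h ^ k) w = 0 := congrArg Subtype.val hw
          apply Subtype.ext
          rw [← ρ.inv_self_apply (h ^ k) w, hw', map_zero]
          rfl
        rw [this, finrank_bot]
        exact zero_le_one
      · refine (finrank_eigenspace_pow_restrict_le_finrank_eigenspace ρ hk.pos hcompl.disjoint
          (fun i hi0 hi => ?_) hWk hμ).trans (hsimple.2 μ)
        exact le_iSup (fun x : {x : H // x ∉ G} => W.map (ρ x))
          ⟨h ^ i, pow_notMem_of_prime_card_quotient G hk hcard hh hi0 hi⟩
  · intro hall
    obtain ⟨W, hW0, hW, hWs⟩ := exists_minimal_invariant_submodule G ρ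
    have hcompl := isCompl_iSup_map_notMem G ρ hk hcard hirr hW0 (hproper W hWs) hW hWs
    exact ⟨hdiag, fun μ =>
      (finrank_eigenspace_le_finrank_eigenspace_pow_restrict G ρ hgen hhk hirr hW0
        (mem_iSup_map_notMem_of_mem G ρ hW) hcompl (hW _ hhk) μ).trans
      ((hall W hW0 hW hWs (hW _ hhk)).2 (μ ^ k))⟩
end

section
/- Let t_1, t_2 ∈ F^× and set t = diag(t_1, t_2, (t_1 t_2)^{-1}), and let h be the corresponding endomorphism of sl_3(F). Let s, s' ∈ F satisfy s² = t_1 t_2^{-1} and s'² = t_1^{-1} t_2. Then h is diagonalizable and the set of eigenvalues of h on sl_3(F) is exactly {1, −1, −t_1 t_2^{-1}, −t_1^{-1} t_2, s, −s, s', −s'}. -/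
noncomputable section

/-- `sl₃(F)`: the space of traceless `3 × 3` matrices over `F`. -/
def sl3 (F : Type*) [Field F] : Submodule F (Matrix (Fin 3) (Fin 3) F) :=
  LinearMap.ker (Matrix.traceLinearMap (Fin 3) F F)

/-- The matrix `n_w` with rows `(0,1,0)`, `(1,0,0)`, `(0,0,-1)`. -/
def nw (F : Type*) [Field F] : Matrix (Fin 3) (Fin 3) F :=
  !![0, 1, 0; 1, 0, 0; 0, 0, -1]

/-- The endomorphism `X ↦ -((n_w t) X (n_w t)⁻¹)ᵀ` of the space of `3 × 3` matrices,
where `t = diag(t₁, t₂, t₃)`. -/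
def hFull (F : Type*) [Field F] (t₁ t₂ t₃ : F) :
    Module.End F (Matrix (Fin 3) (Fin 3) F) :=
  -((Matrix.transposeLinearEquiv (Fin 3) (Fin 3) F F).toLinearMap
      ∘ₗ LinearMap.mulRight F (nw F * Matrix.diagonal ![t₁, t₂, t₃])⁻¹
      ∘ₗ LinearMap.mulLeft F (nw F * Matrix.diagonal ![t₁, t₂, t₃]))

theorem mem_iSup_eigenspace_of_apply_apply {K V : Type*} [Field K] [AddCommGroup V] [Module K V]
    (h2 : (2 : K) ≠ 0) (f : Module.End K V) {μ : K} (hμ : μ ≠ 0) {x : V}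
    (hx : f (f x) = μ ^ 2 • x) : x ∈ ⨆ ν : K, f.eigenspace ν := by
  have hpos : x + μ⁻¹ • f x ∈ f.eigenspace μ := by
    rw [Module.End.mem_eigenspace_iff, map_add, map_smul, hx]
    match_scalars <;> field_simp
  have hneg : x - μ⁻¹ • f x ∈ f.eigenspace (-μ) := by
    rw [Module.End.mem_eigenspace_iff, map_sub, map_smul, hx]
    match_scalars <;> field_simp
  have hsum : x = (2 : K)⁻¹ • ((x + μ⁻¹ • f x) + (x - μ⁻¹ • f x)) := by
    match_scalars <;> field_simp <;> ring
  rw [hsum]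
  exact Submodule.smul_mem _ _ (add_mem (Submodule.mem_iSup_of_mem μ hpos)
    (Submodule.mem_iSup_of_mem (-μ) hneg))

section

variable {F : Type*} [Field F]

theorem mem_sl3_iff (X : Matrix (Fin 3) (Fin 3) F) :
    X ∈ sl3 F ↔ X 0 0 + X 1 1 + X 2 2 = 0 := by
  simp [sl3, Matrix.trace_fin_three]

theorem nw_mul_diagonal (t₁ t₂ t₃ : F) :
    nw F * Matrix.diagonal ![t₁, t₂, t₃] = !![0, t₂, 0; t₁, 0, 0; 0, 0, -t₃] := by
  ext i j
  fin_cases i <;> fin_cases j <;> simp [nw, Matrix.mul_diagonal, -Matrix.cons_mul]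

theorem nw_mul_diagonal_inv {t₁ t₂ t₃ : F} (h₁ : t₁ ≠ 0) (h₂ : t₂ ≠ 0) (h₃ : t₃ ≠ 0) :
    (nw F * Matrix.diagonal ![t₁, t₂, t₃])⁻¹ = !![0, t₁⁻¹, 0; t₂⁻¹, 0, 0; 0, 0, -t₃⁻¹] := by
  rw [nw_mul_diagonal]
  apply Matrix.inv_eq_right_inv
  ext i j
  fin_cases i <;> fin_cases j <;> simp [h₁, h₂, h₃]

theorem hFull_apply {t₁ t₂ t₃ : F} (h₁ : t₁ ≠ 0) (h₂ : t₂ ≠ 0) (h₃ : t₃ ≠ 0)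
    (X : Matrix (Fin 3) (Fin 3) F) :
    hFull F t₁ t₂ t₃ X =
      !![-X 1 1, -(t₁ / t₂ * X 0 1), t₃ / t₂ * X 2 1;
        -(t₂ / t₁ * X 1 0), -X 0 0, t₃ / t₁ * X 2 0;
        t₂ / t₃ * X 1 2, t₁ / t₃ * X 0 2, -X 2 2] := by
  rw [hFull, nw_mul_diagonal_inv h₁ h₂ h₃, nw_mul_diagonal]
  ext i j
  fin_cases i <;> fin_cases j <;>
    simp [Matrix.mul_apply, Fin.sum_univ_three, -Matrix.cons_mul] <;> field_simp

theorem hasEigenvalue_restrict_of_apply_eq_smul {V : Type*} [AddCommGroup V] [Module F V]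
    {f : Module.End F V} {p : Submodule F V} (hf : ∀ x ∈ p, f x ∈ p) {μ : F} {x : V}
    (hx : x ∈ p) (hx0 : x ≠ 0) (hfx : f x = μ • x) :
    Module.End.HasEigenvalue (f.restrict hf) μ :=
  Module.End.hasEigenvalue_of_hasEigenvector (x := ⟨x, hx⟩)
    ⟨Module.End.mem_eigenspace_iff.2 (Subtype.ext hfx), fun h => hx0 (congrArg Subtype.val h)⟩

theorem iSup_eigenspace_hFull_restrict (h2 : (2 : F) ≠ 0) {t₁ t₂ t₃ s s' : F}
    (h₁ : t₁ ≠ 0) (h₂ : t₂ ≠ 0) (h₃ : t₃ ≠ 0) (hs : s ^ 2 = t₁ / t₂) (hs' : s' ^ 2 = t₂ / t₁)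
    (hinv : ∀ X ∈ sl3 F, hFull F t₁ t₂ t₃ X ∈ sl3 F) :
    (⨆ μ : F, Module.End.eigenspace ((hFull F t₁ t₂ t₃).restrict hinv) μ) = ⊤ := by
  have hs0 : s ≠ 0 := by rintro rfl; simp [h₁, h₂, eq_comm] at hs
  have hs0' : s' ≠ 0 := by rintro rfl; simp [h₁, h₂, eq_comm] at hs'
  have key : ∀ {μ : F} (_ : μ ≠ 0) (Y : Matrix (Fin 3) (Fin 3) F) (hY : Y ∈ sl3 F),
      hFull F t₁ t₂ t₃ (hFull F t₁ t₂ t₃ Y) = μ ^ 2 • Y →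
      (⟨Y, hY⟩ : sl3 F) ∈ ⨆ μ : F, Module.End.eigenspace ((hFull F t₁ t₂ t₃).restrict hinv) μ :=
    fun hμ Y hY h => mem_iSup_eigenspace_of_apply_apply h2 _ hμ (Subtype.ext h)
  rw [eq_top_iff]
  rintro ⟨X, hX⟩ -
  have hD := key one_ne_zero !![X 0 0, 0, 0; 0, X 1 1, 0; 0, 0, X 2 2]
    (by simpa [mem_sl3_iff] using hX)
    (by rw [hFull_apply h₁ h₂ h₃, hFull_apply h₁ h₂ h₃]
        ext i j; fin_cases i <;> fin_cases j <;> simp)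
  have hA := key (div_ne_zero h₁ h₂) !![0, X 0 1, 0; 0, 0, 0; 0, 0, 0]
    (by simp [mem_sl3_iff])
    (by rw [hFull_apply h₁ h₂ h₃, hFull_apply h₁ h₂ h₃]
        ext i j; fin_cases i <;> fin_cases j <;> simp <;> ring)
  have hA' := key (div_ne_zero h₂ h₁) !![0, 0, 0; X 1 0, 0, 0; 0, 0, 0]
    (by simp [mem_sl3_iff])
    (by rw [hFull_apply h₁ h₂ h₃, hFull_apply h₁ h₂ h₃]
        ext i j; fin_cases i <;> fin_cases j <;> simp <;> ring)
  have hB := key hs0 !![0, 0, X 0 2; 0, 0, 0; 0, X 2 1, 0]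
    (by simp [mem_sl3_iff])
    (by rw [hFull_apply h₁ h₂ h₃, hFull_apply h₁ h₂ h₃, hs]
        ext i j; fin_cases i <;> fin_cases j <;> simp <;> field_simp)
  have hB' := key hs0' !![0, 0, 0; 0, 0, X 1 2; X 2 0, 0, 0]
    (by simp [mem_sl3_iff])
    (by rw [hFull_apply h₁ h₂ h₃, hFull_apply h₁ h₂ h₃, hs']
        ext i j; fin_cases i <;> fin_cases j <;> simp <;> field_simp)
  convert add_mem (add_mem (add_mem (add_mem hD hA) hA') hB) hB'
  ext i j
  fin_cases i <;> fin_cases j <;> simp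

theorem mem_of_hasEigenvalue_hFull_restrict {t₁ t₂ t₃ s s' : F}
    (h₁ : t₁ ≠ 0) (h₂ : t₂ ≠ 0) (h₃ : t₃ ≠ 0) (hs : s ^ 2 = t₁ / t₂) (hs' : s' ^ 2 = t₂ / t₁)
    (hinv : ∀ X ∈ sl3 F, hFull F t₁ t₂ t₃ X ∈ sl3 F) {μ : F}
    (hμ : Module.End.HasEigenvalue ((hFull F t₁ t₂ t₃).restrict hinv) μ) :
    μ ∈ ({1, -1, -(t₁ / t₂), -(t₂ / t₁), s, -s, s', -s'} : Set F) := by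
  obtain ⟨⟨X, hX⟩, hXμ, hX0⟩ := hμ.exists_hasEigenvector
  have hfX : hFull F t₁ t₂ t₃ X = μ • X :=
    congrArg Subtype.val (Module.End.mem_eigenspace_iff.1 hXμ)
  rw [hFull_apply h₁ h₂ h₃] at hfX
  have entry (i j : Fin 3) := congrFun (congrFun hfX i) j
  have e00 := entry 0 0
  have e01 := entry 0 1
  have e02 := entry 0 2
  have e10 := entry 1 0
  have e11 := entry 1 1
  have e12 := entry 1 2
  have e20 := entry 2 0
  have e21 := entry 2 1
  have e22 := entry 2 2
  simp at e00 e01 e02 e10 e11 e12 e20 e21 e22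
  by_contra hne
  simp only [Set.mem_insert_iff, Set.mem_singleton_iff, not_or] at hne
  obtain ⟨n1, n1', nt, nt', ns, nsn, ns', nsn'⟩ := hne
  have sq_ne {a : F} (h : μ ≠ a) (h' : μ ≠ -a) : μ ^ 2 - a ^ 2 ≠ 0 := by
    rw [sq_sub_sq]
    exact mul_ne_zero (fun h0 => h' (eq_neg_of_add_eq_zero_left h0)) (sub_ne_zero.2 h)
  have m1 := sq_ne n1 n1'
  have ms := hs ▸ sq_ne ns nsn
  have ms' := hs' ▸ sq_ne ns' nsn'
  have x00 : X 0 0 = 0 := (mul_eq_zero_iff_left m1).1 (by linear_combination -μ * e00 + e11)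
  have x11 : X 1 1 = 0 := (mul_eq_zero_iff_left m1).1 (by linear_combination -μ * e11 + e00)
  have x22 : X 2 2 = 0 := (mul_eq_zero_iff_left (sub_ne_zero.2 n1')).1 (by linear_combination -e22)
  have x01 : X 0 1 = 0 := (mul_eq_zero_iff_left (sub_ne_zero.2 nt)).1 (by linear_combination -e01)
  have x10 : X 1 0 = 0 := (mul_eq_zero_iff_left (sub_ne_zero.2 nt')).1 (by linear_combination -e10)
  have x02 : X 0 2 = 0 := (mul_eq_zero_iff_left ms).1 (by
    have c : t₃ / t₂ * (t₁ / t₃) = t₁ / t₂ := by field_simp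
    linear_combination -μ * e02 - t₃ / t₂ * e21 + c * X 0 2)
  have x21 : X 2 1 = 0 := (mul_eq_zero_iff_left ms).1 (by
    have c : t₃ / t₂ * (t₁ / t₃) = t₁ / t₂ := by field_simp
    linear_combination -μ * e21 - t₁ / t₃ * e02 + c * X 2 1)
  have x12 : X 1 2 = 0 := (mul_eq_zero_iff_left ms').1 (by
    have c : t₃ / t₁ * (t₂ / t₃) = t₂ / t₁ := by field_simp
    linear_combination -μ * e12 - t₃ / t₁ * e20 + c * X 1 2)
  have x20 : X 2 0 = 0 := (mul_eq_zero_iff_left ms').1 (by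
    have c : t₃ / t₁ * (t₂ / t₃) = t₂ / t₁ := by field_simp
    linear_combination -μ * e20 - t₂ / t₃ * e12 + c * X 2 0)
  refine hX0 (Subtype.ext ?_)
  ext i j
  fin_cases i <;> fin_cases j <;> assumption

theorem hasEigenvalue_hFull_restrict_of_mem {t₁ t₂ t₃ s s' : F}
    (h₁ : t₁ ≠ 0) (h₂ : t₂ ≠ 0) (h₃ : t₃ ≠ 0) (hs : s ^ 2 = t₁ / t₂) (hs' : s' ^ 2 = t₂ / t₁)
    (hinv : ∀ X ∈ sl3 F, hFull F t₁ t₂ t₃ X ∈ sl3 F) {μ : F}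
    (hμ : μ ∈ ({1, -1, -(t₁ / t₂), -(t₂ / t₁), s, -s, s', -s'} : Set F)) :
    Module.End.HasEigenvalue ((hFull F t₁ t₂ t₃).restrict hinv) μ := by
  have key (X : Matrix (Fin 3) (Fin 3) F) (i j : Fin 3) (hX : X ∈ sl3 F) (h1 : X i j = 1)
      (hf : hFull F t₁ t₂ t₃ X = μ • X) :
      Module.End.HasEigenvalue ((hFull F t₁ t₂ t₃).restrict hinv) μ :=
    hasEigenvalue_restrict_of_apply_eq_smul hinv hX (by rintro rfl; simp at h1) hf
  have hsq (h : μ ^ 2 = t₁ / t₂) :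
      Module.End.HasEigenvalue ((hFull F t₁ t₂ t₃).restrict hinv) μ := by
    refine key !![0, 0, 1; 0, 0, 0; 0, μ * (t₂ / t₃), 0] 0 2 (by simp [mem_sl3_iff]) rfl ?_
    have c : t₁ / t₃ = μ * (μ * (t₂ / t₃)) := by rw [← mul_assoc, ← sq, h]; field_simp
    rw [hFull_apply h₁ h₂ h₃]
    ext i j
    fin_cases i <;> fin_cases j <;> simp [c] <;> field_simp
  have hsq' (h : μ ^ 2 = t₂ / t₁) :
      Module.End.HasEigenvalue ((hFull F t₁ t₂ t₃).restrict hinv) μ := by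
    refine key !![0, 0, 0; 0, 0, 1; μ * (t₁ / t₃), 0, 0] 1 2 (by simp [mem_sl3_iff]) rfl ?_
    have c : t₂ / t₃ = μ * (μ * (t₁ / t₃)) := by rw [← mul_assoc, ← sq, h]; field_simp
    rw [hFull_apply h₁ h₂ h₃]
    ext i j
    fin_cases i <;> fin_cases j <;> simp [c] <;> field_simp
  rcases hμ with rfl | rfl | rfl | rfl | rfl | rfl | rfl | rfl
  · refine key !![1, 0, 0; 0, -1, 0; 0, 0, 0] 0 0 (by simp [mem_sl3_iff]) rfl ?_
    rw [hFull_apply h₁ h₂ h₃]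
    ext i j
    fin_cases i <;> fin_cases j <;> simp
  · refine key !![1, 0, 0; 0, 1, 0; 0, 0, -2] 0 0 (by simp [mem_sl3_iff]; norm_num) rfl ?_
    rw [hFull_apply h₁ h₂ h₃]
    ext i j
    fin_cases i <;> fin_cases j <;> simp
  · refine key !![0, 1, 0; 0, 0, 0; 0, 0, 0] 0 1 (by simp [mem_sl3_iff]) rfl ?_
    rw [hFull_apply h₁ h₂ h₃]
    ext i j
    fin_cases i <;> fin_cases j <;> simp
  · refine key !![0, 0, 0; 1, 0, 0; 0, 0, 0] 1 0 (by simp [mem_sl3_iff]) rfl ?_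
    rw [hFull_apply h₁ h₂ h₃]
    ext i j
    fin_cases i <;> fin_cases j <;> simp
  · exact hsq hs
  · exact hsq (by rw [neg_sq, hs])
  · exact hsq' hs'
  · exact hsq' (by rw [neg_sq, hs'])

end

/-- With `t = diag(t₁, t₂, (t₁t₂)⁻¹)` and `s² = t₁t₂⁻¹`, `s'² = t₁⁻¹t₂`, the endomorphism
`h : X ↦ -((n_w t) X (n_w t)⁻¹)ᵀ` of `sl₃(F)` is diagonalizable and its set of eigenvalues
is exactly `{1, -1, -t₁t₂⁻¹, -t₁⁻¹t₂, s, -s, s', -s'}`. -/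
theorem stmt_4 (F : Type*) [Field F] [IsAlgClosed F]
    (hchar2 : (2 : F) ≠ 0) (hchar3 : (3 : F) ≠ 0)
    (t₁ t₂ : F) (ht₁ : t₁ ≠ 0) (ht₂ : t₂ ≠ 0)
    (s s' : F) (hs : s ^ 2 = t₁ * t₂⁻¹) (hs' : s' ^ 2 = t₁⁻¹ * t₂)
    (hinv : ∀ X ∈ sl3 F, hFull F t₁ t₂ (t₁ * t₂)⁻¹ X ∈ sl3 F) :
    (⨆ μ : F, Module.End.eigenspace ((hFull F t₁ t₂ (t₁ * t₂)⁻¹).restrict hinv) μ) = ⊤ ∧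
    {μ : F | Module.End.HasEigenvalue ((hFull F t₁ t₂ (t₁ * t₂)⁻¹).restrict hinv) μ}
      = {1, -1, -(t₁ * t₂⁻¹), -(t₁⁻¹ * t₂), s, -s, s', -s'} := by
  have h₃ : (t₁ * t₂)⁻¹ ≠ 0 := inv_ne_zero (mul_ne_zero ht₁ ht₂)
  rw [← div_eq_mul_inv] at hs
  rw [inv_mul_eq_div] at hs'
  refine ⟨iSup_eigenspace_hFull_restrict hchar2 ht₁ ht₂ h₃ hs hs' hinv, ?_⟩
  rw [← div_eq_mul_inv, inv_mul_eq_div]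
  exact Set.ext fun μ => ⟨mem_of_hasEigenvalue_hFull_restrict ht₁ ht₂ h₃ hs hs' hinv,
    hasEigenvalue_hFull_restrict_of_mem ht₁ ht₂ h₃ hs hs' hinv⟩
end
end

section
/- Let ζ ∈ F satisfy ζ⁴ = −1, set t_1 = ζ² and t = diag(t_1, 1, t_1^{-1}), and let h be the corresponding endomorphism of sl_3(F). Then h has simple spectrum on sl_3(F), and the set of eigenvalues of h is exactly the set of all eighth roots of unity in F. -/
noncomputable section

section SimpleSpectrum

variable {ι F V : Type*} [Field F] [AddCommGroup V] [Module F V]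

theorem Module.Basis.repr_apply_eq_mul_of_hasEigenvector {f : Module.End F V} {μ : ι → F}
    (b : Module.Basis ι F V) (hb : ∀ i, f (b i) = μ i • b i) (x : V) (i : ι) :
    b.repr (f x) i = μ i * b.repr x i := by
  have h : b.coord i ∘ₗ f = μ i • b.coord i := b.ext fun j => by
    by_cases hij : j = i
    · subst hij; simp [hb]
    · simp [hb, Finsupp.single_eq_of_ne' hij]
  exact LinearMap.congr_fun h x

theorem hasSimpleSpectrum_of_basis {f : Module.End F V} {μ : ι → F}
    (hμ : Function.Injective μ) (b : Module.Basis ι F V) (hb : ∀ i, f (b i) = μ i • b i) :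
    HasSimpleSpectrum f := by
  refine ⟨?_, fun ν => ?_⟩
  · rw [eq_top_iff, ← b.span_eq, Submodule.span_le]
    rintro _ ⟨i, rfl⟩
    exact Submodule.mem_iSup_of_mem (μ i) (Module.End.mem_eigenspace_iff.2 (hb i))
  · have key : ∀ x ∈ f.eigenspace ν, ∀ i, μ i ≠ ν → b.repr x i = 0 := by
      intro x hx i hi
      have h := b.repr_apply_eq_mul_of_hasEigenvector hb x i
      rw [Module.End.mem_eigenspace_iff.1 hx] at h
      have h' : (μ i - ν) * b.repr x i = 0 := by
        rw [sub_mul, ← h]; simp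
      exact (mul_eq_zero.1 h').resolve_left (sub_ne_zero.2 hi)
    by_cases hν : ∃ j, μ j = ν
    · obtain ⟨j, rfl⟩ := hν
      refine finrank_le_one ⟨b j, Module.End.mem_eigenspace_iff.2 (hb j)⟩ fun x => ?_
      refine ⟨b.repr x j, Subtype.ext (b.ext_elem fun i => ?_)⟩
      by_cases hij : i = j
      · subst hij; simp
      · simp [key x x.2 i (hμ.ne hij), Ne.symm hij]
    · push Not at hν
      refine finrank_le_one 0 fun x => ⟨0, Subtype.ext (b.ext_elem fun i => ?_)⟩
      simp [key x x.2 i (hν i)]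

theorem setOf_hasEigenvalue_eq_range_of_basis {f : Module.End F V} {μ : ι → F}
    (b : Module.Basis ι F V) (hb : ∀ i, f (b i) = μ i • b i) :
    {ν : F | f.HasEigenvalue ν} = Set.range μ := by
  ext ν
  constructor
  · intro h
    obtain ⟨x, hx⟩ := Module.End.HasEigenvalue.exists_hasEigenvector h
    by_contra hν
    refine hx.2 (b.ext_elem fun i => ?_)
    have h := b.repr_apply_eq_mul_of_hasEigenvector hb x i
    rw [hx.apply_eq_smul] at h
    have h' : (μ i - ν) * b.repr x i = 0 := by
      rw [sub_mul, ← h]; simp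
    simpa using (mul_eq_zero.1 h').resolve_left (sub_ne_zero.2 fun e => hν ⟨i, e⟩)
  · rintro ⟨i, rfl⟩
    exact Module.End.hasEigenvalue_of_hasEigenvector
      ⟨Module.End.mem_eigenspace_iff.2 (hb i), b.ne_zero i⟩

end SimpleSpectrum

theorem finrank_sl3 (F : Type*) [Field F] : Module.finrank F (sl3 F) = 8 := by
  have h := LinearMap.finrank_range_add_finrank_ker (Matrix.traceLinearMap (Fin 3) F F)
  have hs : LinearMap.range (Matrix.traceLinearMap (Fin 3) F F) = ⊤ := by
    refine LinearMap.range_eq_top.2 fun a => ⟨!![a, 0, 0; 0, 0, 0; 0, 0, 0], ?_⟩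
    simp [Matrix.trace_fin_three]
  rw [hs, finrank_top, Module.finrank_self, Module.finrank_matrix] at h
  simp only [Module.finrank_self, Fintype.card_fin] at h
  change 1 + Module.finrank F (sl3 F) = _ at h
  omega

theorem hFull_apply_s6 {F : Type*} [Field F] {t : F} (ht : t ≠ 0) (X : Matrix (Fin 3) (Fin 3) F) :
    hFull F t 1 t⁻¹ X =
      !![-X 1 1, -(t * X 0 1), t⁻¹ * X 2 1;
         -(t⁻¹ * X 1 0), -X 0 0, t⁻¹ * t⁻¹ * X 2 0;
         t * X 1 2, t * t * X 0 2, -X 2 2] := by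
  have hM : nw F * Matrix.diagonal ![t, 1, t⁻¹] = !![0, 1, 0; t, 0, 0; 0, 0, -t⁻¹] := by
    ext i j
    fin_cases i <;> fin_cases j <;> simp [nw]
  have hMinv : (!![0, 1, 0; t, 0, 0; 0, 0, -t⁻¹] : Matrix (Fin 3) (Fin 3) F)⁻¹ =
      !![0, t⁻¹, 0; 1, 0, 0; 0, 0, -t] := by
    refine Matrix.inv_eq_right_inv ?_
    ext i j
    fin_cases i <;> fin_cases j <;> simp [Matrix.mul_apply, Fin.sum_univ_three, ht]
  rw [hFull, hM, hMinv]
  ext i j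
  fin_cases i <;> fin_cases j <;>
    simp [Matrix.mul_apply, Fin.sum_univ_three, Matrix.vecMul, Matrix.vecHead, Matrix.vecTail] <;>
    field_simp

/-- Eigenvectors of `hFull F (ζ ^ 2) 1 (ζ ^ 2)⁻¹`, the `k`-th one with eigenvalue `ζ ^ k`. -/
def eigenmatrix {F : Type*} [Field F] (ζ : F) : Fin 8 → Matrix (Fin 3) (Fin 3) F :=
  ![!![1, 0, 0; 0, -1, 0; 0, 0, 0],
    !![0, 0, -ζ; 0, 0, 0; 0, 1, 0],
    !![0, 0, 0; 1, 0, 0; 0, 0, 0],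
    !![0, 0, 0; 0, 0, 1; -ζ ^ 3, 0, 0],
    !![1, 0, 0; 0, 1, 0; 0, 0, -2],
    !![0, 0, ζ; 0, 0, 0; 0, 1, 0],
    !![0, 1, 0; 0, 0, 0; 0, 0, 0],
    !![0, 0, 0; 0, 0, 1; ζ ^ 3, 0, 0]]

theorem eigenmatrix_mem_sl3 {F : Type*} [Field F] (ζ : F) (k : Fin 8) :
    eigenmatrix ζ k ∈ sl3 F := by
  rw [sl3, LinearMap.mem_ker]
  fin_cases k <;> simp [eigenmatrix, Matrix.trace_fin_three]
  norm_num

theorem eigenmatrix_ne_zero {F : Type*} [Field F] (ζ : F) (k : Fin 8) :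
    eigenmatrix ζ k ≠ 0 := by
  intro h
  have h' := fun i j => congrFun (congrFun h i) j
  fin_cases k <;> simp [eigenmatrix, Fin.forall_fin_succ] at h'

theorem hFull_eigenmatrix {F : Type*} [Field F] {ζ : F} (hζ : ζ ^ 4 = -1) (k : Fin 8) :
    hFull F (ζ ^ 2) 1 (ζ ^ 2)⁻¹ (eigenmatrix ζ k) = ζ ^ (k : ℕ) • eigenmatrix ζ k := by
  have h0 : ζ ≠ 0 := by rintro rfl; simp at hζ
  have hi : (ζ ^ 2)⁻¹ = -ζ ^ 2 :=
    inv_eq_of_mul_eq_one_right (by linear_combination -hζ)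
  rw [hFull_apply_s6 (pow_ne_zero 2 h0), hi]
  ext i j
  fin_cases k <;> fin_cases i <;> fin_cases j <;> simp [eigenmatrix] <;> grind

theorem isPrimitiveRoot_eight_of_pow_four {F : Type*} [Field F] (h2 : (2 : F) ≠ 0) {ζ : F}
    (hζ : ζ ^ 4 = -1) : IsPrimitiveRoot ζ 8 := by
  have h := orderOf_eq_prime_pow (p := 2) (n := 2) (x := ζ)
    (by norm_num [hζ]; intro h; apply h2; linear_combination -h)
    (by norm_num; linear_combination (ζ ^ 4 - 1) * hζ)
  norm_num at h
  exact h ▸ IsPrimitiveRoot.orderOf ζ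

/-- With `ζ⁴ = -1`, `t₁ = ζ²` and `t = diag(t₁, 1, t₁⁻¹)`, the endomorphism
`h : X ↦ -((n_w t) X (n_w t)⁻¹)ᵀ` of `sl₃(F)` has simple spectrum, and its set of
eigenvalues is exactly the set of eighth roots of unity in `F`. -/
theorem stmt_6 (F : Type*) [Field F] [IsAlgClosed F]
    (hchar2 : (2 : F) ≠ 0) (hchar3 : (3 : F) ≠ 0)
    (ζ : F) (hζ : ζ ^ 4 = -1) (t₁ : F) (ht₁ : t₁ = ζ ^ 2)
    (hinv : ∀ X ∈ sl3 F, hFull F t₁ 1 t₁⁻¹ X ∈ sl3 F) :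
    HasSimpleSpectrum ((hFull F t₁ 1 t₁⁻¹).restrict hinv) ∧
    {μ : F | Module.End.HasEigenvalue ((hFull F t₁ 1 t₁⁻¹).restrict hinv) μ}
      = {x : F | x ^ 8 = 1} := by
  subst ht₁
  have hprim := isPrimitiveRoot_eight_of_pow_four hchar2 hζ
  set f := (hFull F (ζ ^ 2) 1 (ζ ^ 2)⁻¹).restrict hinv
  let μ : Fin 8 → F := fun k => ζ ^ (k : ℕ)
  let v : Fin 8 → sl3 F := fun k => ⟨eigenmatrix ζ k, eigenmatrix_mem_sl3 ζ k⟩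
  have hμ : Function.Injective μ := fun i j h => Fin.ext (hprim.pow_inj i.2 j.2 h)
  have hv : ∀ k, f (v k) = μ k • v k := fun k => Subtype.ext (hFull_eigenmatrix hζ k)
  have hli : LinearIndependent F v :=
    Module.End.eigenvectors_linearIndependent' f μ hμ v fun k =>
      ⟨Module.End.mem_eigenspace_iff.2 (hv k),
        fun h => eigenmatrix_ne_zero ζ k (congrArg Subtype.val h)⟩
  let b := basisOfLinearIndependentOfCardEqFinrank hli (by simp [finrank_sl3])
  have hb : ∀ k, f (b k) = μ k • b k := by simpa [b] using hv
  refine ⟨hasSimpleSpectrum_of_basis hμ b hb, ?_⟩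
  rw [setOf_hasEigenvalue_eq_range_of_basis b hb]
  ext x
  constructor
  · rintro ⟨k, rfl⟩
    change (ζ ^ (k : ℕ)) ^ 8 = 1
    rw [pow_right_comm, hprim.pow_eq_one, one_pow]
  · intro hx
    obtain ⟨k, hk, rfl⟩ := hprim.eq_pow_of_pow_eq_one hx
    exact ⟨⟨k, hk⟩, rfl⟩
end
end

section
/- Let q = 2^m with q > 8, let ξ ∈ F have multiplicative order q − 1, and let u_1, u_2, u_3 ∈ F satisfy u_1³ = ξ^{-1}, u_2³ = ξ⁵, u_3³ = ξ⁴. Then the 26 elements ζ, ζ², ξ, ξ^{-1}, ξ², ξ^{-2}, ξ³, ξ^{-3}, together with ζ^i u_j and ζ^i u_j^{-1} for i ∈ {0,1,2} and j ∈ {1,2,3}, are pairwise distinct. (These are the eigenvalues of a simple-spectrum element h = σt in the extension of D_4(q) by a triality automorphism acting on the 26-dimensional module with highest weight ω_2, obtained from the choice t_1 = ξ, t_2 = ξ², t_3 = 1.) -/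
/-- The list of pairs `(i, a)` indexing the eigenvalues `ζ ^ i * w a`, where `w a ^ 3 = ξ ^ a`. -/
def eigenvalueIndices : List (ℕ × ℤ) :=
  [(1, 0), (2, 0), (0, 3), (0, -3), (0, 6), (0, -6), (0, 9), (0, -9),
    (0, -1), (0, 1), (0, 5), (0, -5), (0, 4), (0, -4),
    (1, -1), (1, 1), (1, 5), (1, -5), (1, 4), (1, -4),
    (2, -1), (2, 1), (2, 5), (2, -5), (2, 4), (2, -4)]

/-- The chosen cube root of `ξ ^ a`, for the exponents `a` occurring in `eigenvalueIndices`. -/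
def chosenCubeRoot {F : Type*} [Field F] (ξ u₁ u₂ u₃ : F) : ℤ → F
  | 3 => ξ
  | -3 => ξ⁻¹
  | 6 => ξ ^ 2
  | -6 => (ξ ^ 2)⁻¹
  | 9 => ξ ^ 3
  | -9 => (ξ ^ 3)⁻¹
  | -1 => u₁
  | 1 => u₁⁻¹
  | 5 => u₂
  | -5 => u₂⁻¹
  | 4 => u₃
  | -4 => u₃⁻¹
  | _ => 1

theorem chosenCubeRoot_pow_three {F : Type*} [Field F] {ξ u₁ u₂ u₃ : F}
    (hu₁ : u₁ ^ 3 = ξ⁻¹) (hu₂ : u₂ ^ 3 = ξ ^ 5) (hu₃ : u₃ ^ 3 = ξ ^ 4) :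
    ∀ p ∈ eigenvalueIndices, chosenCubeRoot ξ u₁ u₂ u₃ p.2 ^ 3 = ξ ^ p.2 := by
  simp only [eigenvalueIndices, List.forall_mem_cons, chosenCubeRoot, inv_pow, ← pow_mul,
    hu₁, hu₂, hu₃, zpow_neg, inv_inv, zpow_zero, one_pow, zpow_one, true_and]
  norm_cast
  simp

theorem orderOf_eq_three_of_sq_add_self_add_one {F : Type*} [Field F] [CharP F 2] {ζ : F}
    (hζ : ζ ^ 2 + ζ + 1 = 0) : orderOf ζ = 3 := by
  refine orderOf_eq_prime (by linear_combination (ζ - 1) * hζ) ?_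
  rintro rfl
  have h2 : (2 : F) = 0 := CharP.cast_eq_zero F 2
  exact one_ne_zero (α := F) (by linear_combination hζ - h2)

theorem zpow_eq_one_iff_orderOf_dvd {G₀ : Type*} [GroupWithZero G₀] {x : G₀} (hx : x ≠ 0)
    (n : ℤ) : x ^ n = 1 ↔ (orderOf x : ℤ) ∣ n := by
  lift x to G₀ˣ using hx.isUnit
  rw [orderOf_units, orderOf_dvd_iff_zpow_eq_one]
  norm_cast

theorem eigenvalueIndices_snd_eq_of_dvd {N : ℕ} (hN : N = 15 ∨ 31 ≤ N) :
    ∀ p ∈ eigenvalueIndices, ∀ r ∈ eigenvalueIndices, (N : ℤ) ∣ p.2 - r.2 →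
      p.2 = r.2 ∨ p.1 = 0 ∧ r.1 = 0 ∧
        (p.2, r.2) ∈ ([(9, -6), (-6, 9), (6, -9), (-9, 6)] : List (ℤ × ℤ)) := by
  intro p hp r hr hdvd
  rcases hN with rfl | hN
  · have key : ∀ p ∈ eigenvalueIndices, ∀ r ∈ eigenvalueIndices, (15 : ℤ) ∣ p.2 - r.2 →
        p.2 = r.2 ∨ p.1 = 0 ∧ r.1 = 0 ∧
          (p.2, r.2) ∈ ([(9, -6), (-6, 9), (6, -9), (-9, 6)] : List (ℤ × ℤ)) := by
      decide +kernel
    exact key p hp r hr hdvd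
  · have bound : ∀ p ∈ eigenvalueIndices, |p.2| ≤ 9 := by decide
    have hp9 := abs_le.mp (bound p hp)
    have hr9 := abs_le.mp (bound r hr)
    have h0 := Int.eq_zero_of_abs_lt_dvd hdvd (abs_lt.mpr ⟨by omega, by omega⟩)
    exact Or.inl (by omega)


/-- (Eigenvalues of a simple-spectrum element of `⟨D₄(q), σ⟩` on the 26-dimensional module,
from the choice `t₁ = ξ`, `t₂ = ξ²`, `t₃ = 1`.)  Let `F` be algebraically closed of
characteristic 2, `ζ` a primitive cube root of unity, `q = 2^m > 8`, `ξ` of order `q - 1`,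
and `u₁³ = ξ⁻¹`, `u₂³ = ξ⁵`, `u₃³ = ξ⁴`.  Then the 26 listed elements are pairwise
distinct. -/
theorem stmt_9 (F : Type*) [Field F] [IsAlgClosed F] [CharP F 2]
    (ζ : F) (hζ : ζ ^ 2 + ζ + 1 = 0)
    (q : ℕ) (m : ℕ) (hq : q = 2 ^ m) (hq8 : 8 < q)
    (ξ : F) (hξ : orderOf ξ = q - 1)
    (u₁ u₂ u₃ : F) (hu₁ : u₁ ^ 3 = ξ⁻¹) (hu₂ : u₂ ^ 3 = ξ ^ 5) (hu₃ : u₃ ^ 3 = ξ ^ 4) :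
    ([ζ, ζ ^ 2, ξ, ξ⁻¹, ξ ^ 2, (ξ ^ 2)⁻¹, ξ ^ 3, (ξ ^ 3)⁻¹,
      u₁, u₁⁻¹, u₂, u₂⁻¹, u₃, u₃⁻¹,
      ζ * u₁, ζ * u₁⁻¹, ζ * u₂, ζ * u₂⁻¹, ζ * u₃, ζ * u₃⁻¹,
      ζ ^ 2 * u₁, ζ ^ 2 * u₁⁻¹, ζ ^ 2 * u₂, ζ ^ 2 * u₂⁻¹, ζ ^ 2 * u₃, ζ ^ 2 * u₃⁻¹] :
      List F).Nodup := by
  have hN : q - 1 = 15 ∨ 31 ≤ q - 1 := by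
    have hm : 3 < m := (Nat.pow_lt_pow_iff_right (a := 2) (by norm_num)).mp (by omega)
    rcases Nat.lt_or_ge m 5 with h | h
    · obtain rfl : m = 4 := by omega
      omega
    · have := Nat.pow_le_pow_right (n := 2) (by norm_num) h
      omega
  have hξ0 : ξ ≠ 0 := by
    rintro rfl
    rw [orderOf_zero] at hξ
    omega
  have hζ3 := orderOf_eq_three_of_sq_add_self_add_one hζ
  have hζ1 : ζ ^ 3 = 1 := hζ3 ▸ pow_orderOf_eq_one ζ
  have hw := chosenCubeRoot_pow_three hu₁ hu₂ hu₃
  have hξ5 : ξ ^ 5 ≠ 1 := fun h => by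
    have := Nat.le_of_dvd (by norm_num) (orderOf_dvd_of_pow_eq_one h)
    omega
  have hinj : ∀ p ∈ eigenvalueIndices, ∀ r ∈ eigenvalueIndices,
      ζ ^ p.1 * chosenCubeRoot ξ u₁ u₂ u₃ p.2 = ζ ^ r.1 * chosenCubeRoot ξ u₁ u₂ u₃ r.2 →
        p = r := by
    rintro ⟨i, a⟩ hp ⟨j, b⟩ hr h
    have hcube : ξ ^ a = ξ ^ b := by
      have h3 := congrArg (· ^ 3) h
      simpa only [mul_pow, hw _ hp, hw _ hr, pow_right_comm ζ _ 3, hζ1, one_pow, one_mul] using h3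
    have hdvd : ((q - 1 : ℕ) : ℤ) ∣ a - b := by
      rw [← hξ, ← zpow_eq_one_iff_orderOf_dvd hξ0, zpow_sub₀ hξ0, hcube,
        div_self (zpow_ne_zero _ hξ0)]
    rcases eigenvalueIndices_snd_eq_of_dvd hN _ hp _ hr hdvd with hab | ⟨hi, hj, hab⟩
    · obtain rfl : a = b := hab
      have hw0 : chosenCubeRoot ξ u₁ u₂ u₃ a ≠ 0 := fun h0 =>
        zpow_ne_zero a hξ0 (by rw [← hw _ hp, h0, zero_pow three_ne_zero])
      have hlt : ∀ p ∈ eigenvalueIndices, p.1 < 3 := by decide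
      have hij := pow_injOn_Iio_orderOf (by simpa [hζ3] using hlt _ hp)
        (by simpa [hζ3] using hlt _ hr) (mul_right_cancel₀ hw0 h)
      exact Prod.ext hij rfl
    · obtain rfl : i = 0 := hi
      obtain rfl : j = 0 := hj
      refine absurd ?_ hξ5
      simp only [List.mem_cons, Prod.mk.injEq, List.not_mem_nil, or_false] at hab
      rcases hab with ⟨rfl, rfl⟩ | ⟨rfl, rfl⟩ | ⟨rfl, rfl⟩ | ⟨rfl, rfl⟩ <;>
      · simp only [chosenCubeRoot, pow_zero, one_mul] at h
        field_simp at h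
        first | exact h | exact h.symm
  have hnodup := List.Nodup.map_on hinj (by decide +kernel)
  simpa only [eigenvalueIndices, chosenCubeRoot, List.map_cons, List.map_nil, pow_zero, pow_one,
    one_mul, mul_one] using hnodup
end

section
/- Let q = 2^m with q ≥ 32 and 3 not dividing q − 1, and let y ∈ F have multiplicative order q − 1. Then the 26 elements ζ, ζ², y^{±2}, y^{±5}, y^{±7}, and ζ^i y^{±1}, ζ^i y^{±3}, ζ^i y^{±4} for i ∈ {0,1,2}, are pairwise distinct. (These are the eigenvalues of a simple-spectrum element h = tσ in the extension of the triality twisted group ³D_4(q) by a triality automorphism σ, acting on the 26-dimensional module with highest weight ω_2, in the case 3 ∤ (q − 1).) -/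
/-- If `a` and `b` have coprime orders, the exponents in `a ^ i * b ^ k` are determined modulo
the orders of `a` and `b`. -/
theorem orderOf_dvd_sub_of_zpow_mul_zpow_eq {G : Type*} [CommGroup G] {a b : G}
    (hab : (orderOf a).Coprime (orderOf b)) {i j k l : ℤ}
    (h : a ^ i * b ^ k = a ^ j * b ^ l) :
    (orderOf a : ℤ) ∣ i - j ∧ (orderOf b : ℤ) ∣ k - l := by
  have hc : a ^ (i - j) = (b ^ (k - l))⁻¹ := by
    rw [eq_inv_iff_mul_eq_one, zpow_sub, zpow_sub, mul_mul_mul_comm, h, ← mul_inv,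
      mul_inv_cancel]
  have ha : orderOf (b ^ (k - l)) ∣ orderOf a := by
    rw [← orderOf_inv, ← hc]
    exact orderOf_dvd_of_mem_zpowers (Subgroup.zpow_mem_zpowers _ _)
  have hb : b ^ (k - l) = 1 :=
    orderOf_eq_one_iff.1 (Nat.eq_one_of_dvd_coprimes hab ha (orderOf_dvd_of_mem_zpowers (Subgroup.zpow_mem_zpowers _ _)))
  rw [orderOf_dvd_iff_zpow_eq_one, orderOf_dvd_iff_zpow_eq_one, hc, hb]
  simp

/-- (Eigenvalues of a simple-spectrum element of `⟨³D₄(q), σ⟩` on the 26-dimensional module,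
in the case `3 ∤ (q - 1)`.)  Let `F` be algebraically closed of characteristic 2, `ζ` a
primitive cube root of unity, `q = 2^m ≥ 32` with `3 ∤ (q - 1)`, and `y` of order `q - 1`.
Then the 26 listed elements are pairwise distinct. -/
theorem stmt_10 (F : Type*) [Field F] [IsAlgClosed F] [CharP F 2]
    (ζ : F) (hζ : ζ ^ 2 + ζ + 1 = 0)
    (q : ℕ) (m : ℕ) (hq : q = 2 ^ m) (hq32 : 32 ≤ q) (h3 : ¬ (3 ∣ (q - 1)))
    (y : F) (hy : orderOf y = q - 1) :
    ([ζ, ζ ^ 2, y ^ 2, (y ^ 2)⁻¹, y ^ 5, (y ^ 5)⁻¹, y ^ 7, (y ^ 7)⁻¹,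
      y, y⁻¹, y ^ 3, (y ^ 3)⁻¹, y ^ 4, (y ^ 4)⁻¹,
      ζ * y, ζ * y⁻¹, ζ * y ^ 3, ζ * (y ^ 3)⁻¹, ζ * y ^ 4, ζ * (y ^ 4)⁻¹,
      ζ ^ 2 * y, ζ ^ 2 * y⁻¹, ζ ^ 2 * y ^ 3, ζ ^ 2 * (y ^ 3)⁻¹, ζ ^ 2 * y ^ 4,
      ζ ^ 2 * (y ^ 4)⁻¹] : List F).Nodup := by
  have hy0 : y ≠ 0 := by
    rintro rfl
    rw [orderOf_zero] at hy
    omega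
  have hζ0 : ζ ≠ 0 := by
    rintro rfl
    simp at hζ
  have hζ1 : ζ ≠ 1 := by
    rintro rfl
    have h2 : (2 : F) = 0 := CharP.cast_eq_zero F 2
    exact one_ne_zero (α := F) (by linear_combination hζ - h2)
  have hζ3 : orderOf ζ = 3 :=
    orderOf_eq_prime (by linear_combination (ζ - 1) * hζ) hζ1
  lift ζ to Fˣ using hζ0.isUnit
  lift y to Fˣ using hy0.isUnit
  rw [orderOf_units] at hy hζ3
  have hcop : (orderOf ζ).Coprime (orderOf y) := by
    rw [hζ3, hy]
    exact (Nat.Prime.coprime_iff_not_dvd Nat.prime_three).2 h3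
  let exps : List (ℤ × ℤ) := [(1, 0), (2, 0), (0, 2), (0, -2), (0, 5), (0, -5), (0, 7), (0, -7),
    (0, 1), (0, -1), (0, 3), (0, -3), (0, 4), (0, -4),
    (1, 1), (1, -1), (1, 3), (1, -3), (1, 4), (1, -4),
    (2, 1), (2, -1), (2, 3), (2, -3), (2, 4), (2, -4)]
  have hbound : ∀ e ∈ exps, (0 ≤ e.1 ∧ e.1 < 3) ∧ -7 ≤ e.2 ∧ e.2 ≤ 7 := by decide
  have hnodup : (exps.map fun e ↦ ((ζ ^ e.1 * y ^ e.2 : Fˣ) : F)).Nodup := by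
    refine List.Nodup.map_on (fun e he e' he' h ↦ ?_) (by decide)
    obtain ⟨h₁, h₂⟩ := orderOf_dvd_sub_of_zpow_mul_zpow_eq hcop (Units.ext h)
    have b := hbound e he
    have b' := hbound e' he'
    rw [hζ3] at h₁
    rw [hy] at h₂
    have h₂' := Int.eq_zero_of_abs_lt_dvd h₂ (by rw [abs_lt]; omega)
    ext <;> omega
  simpa [exps, zpow_neg, zpow_ofNat] using hnodup
end

section
/- Let q = 2^m with q ≥ 16 and 3 dividing q − 1, let y ∈ F have multiplicative order q − 1, and let c_1, c_2, c_3 ∈ F satisfy c_1³ = y⁸, c_2³ = y^{10}, c_3³ = y². Then the 26 elements ζ, ζ², y^{±2}, y^{±4}, y^{±6}, together with ζ^i c_j and ζ^i c_j^{-1} for i ∈ {0,1,2} and j ∈ {1,2,3}, are pairwise distinct. (These are the eigenvalues of a simple-spectrum element h = tσ in the extension of the triality twisted group ³D_4(q) by a triality automorphism σ, acting on the 26-dimensional module with highest weight ω_2, in the case 3 | (q − 1).) -/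
/-- If `z ≠ 0` has order greater than `n`, then the powers of `z` with exponents at distance at
most `n` are distinct. -/
theorem zpow_inj_of_lt_orderOf {F : Type*} [Field F] {z : F} {n : ℕ} (hz0 : z ≠ 0)
    (hz : n < orderOf z) {a b : ℤ} (hab : |a - b| ≤ n) (h : z ^ a = z ^ b) : a = b := by
  have h1 : z ^ (a - b) = 1 := by rw [zpow_sub₀ hz0, h, div_self (zpow_ne_zero _ hz0)]
  have h2 : z ^ (a - b).natAbs = 1 := by
    rcases Int.natAbs_eq (a - b) with h3 | h3
    · rw [h3, zpow_natCast] at h1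
      exact h1
    · rw [h3, zpow_neg, zpow_natCast, inv_eq_one] at h1
      exact h1
  rw [Int.abs_eq_natAbs] at hab
  by_contra hne
  have h3 := Nat.le_of_dvd (by omega) (orderOf_dvd_of_pow_eq_one h2)
  omega

theorem nodup_map_zpow_of_lt_orderOf {F : Type*} [Field F] {z : F} {n : ℕ} (hz0 : z ≠ 0)
    (hz : n < orderOf z) {l : List ℤ} (hl : l.Nodup) (hln : ∀ a ∈ l, ∀ b ∈ l, |a - b| ≤ n) :
    (l.map (z ^ ·)).Nodup :=
  hl.map_on fun a ha b hb h => zpow_inj_of_lt_orderOf hz0 hz (hln a ha b hb) h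

/-- Multiplying elements with distinct nonzero cubes by the three cube roots of unity gives
pairwise distinct elements. -/
theorem nodup_flatMap_cube_roots {F : Type*} [Field F] {ζ : F} (hζ : IsPrimitiveRoot ζ 3)
    {l : List F} (h0 : ∀ d ∈ l, d ≠ 0) (hl : (l.map (· ^ 3)).Nodup) :
    (l.flatMap fun d => [d, ζ * d, ζ ^ 2 * d]).Nodup := by
  have hζ1 : ζ ≠ 1 := hζ.ne_one (by norm_num)
  have hζ2 : ζ ^ 2 ≠ 1 := hζ.pow_ne_one_of_pos_of_lt (by norm_num) (by norm_num)
  have hζ0 : ζ ≠ 0 := hζ.ne_zero (by norm_num)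
  have hcube : ∀ d x : F, x ∈ [d, ζ * d, ζ ^ 2 * d] → x ^ 3 = d ^ 3 := by
    have := hζ.pow_eq_one
    intro d x hx
    simp only [List.mem_cons, List.not_mem_nil, or_false] at hx
    rcases hx with rfl | rfl | rfl
    · rfl
    · rw [mul_pow, this, one_mul]
    · rw [mul_pow, ← pow_mul, mul_comm 2 3, pow_mul, this, one_pow, one_mul]
  rw [List.nodup_flatMap]
  refine ⟨fun d hd => ?_, ?_⟩
  · have hd0 := h0 d hd
    have h12 : ζ ≠ ζ ^ 2 := fun h => hζ1 (mul_left_cancel₀ hζ0 (by linear_combination -h))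
    simp [hd0, hζ1, hζ2, h12, eq_comm (a := d)]
  · rw [List.Nodup, List.pairwise_map] at hl
    refine hl.imp fun {d e} hde => ?_
    intro x hx hx'
    exact hde ((hcube d x hx).symm.trans (hcube e x hx'))

/-- (Eigenvalues of a simple-spectrum element of `⟨³D₄(q), σ⟩` on the 26-dimensional module,
in the case `3 ∣ (q - 1)`.)  Let `F` be algebraically closed of characteristic 2, `ζ` a
primitive cube root of unity, `q = 2^m ≥ 16` with `3 ∣ (q - 1)`, `y` of order `q - 1`, and
`c₁³ = y⁸`, `c₂³ = y¹⁰`, `c₃³ = y²`.  Then the 26 listed elements are pairwise distinct. -/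
theorem stmt_11 (F : Type*) [Field F] [IsAlgClosed F] [CharP F 2]
    (ζ : F) (hζ : ζ ^ 2 + ζ + 1 = 0)
    (q : ℕ) (m : ℕ) (hq : q = 2 ^ m) (hq16 : 16 ≤ q) (h3 : 3 ∣ (q - 1))
    (y : F) (hy : orderOf y = q - 1)
    (c₁ c₂ c₃ : F) (hc₁ : c₁ ^ 3 = y ^ 8) (hc₂ : c₂ ^ 3 = y ^ 10) (hc₃ : c₃ ^ 3 = y ^ 2) :
    ([ζ, ζ ^ 2, y ^ 2, (y ^ 2)⁻¹, y ^ 4, (y ^ 4)⁻¹, y ^ 6, (y ^ 6)⁻¹,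
      c₁, c₁⁻¹, c₂, c₂⁻¹, c₃, c₃⁻¹,
      ζ * c₁, ζ * c₁⁻¹, ζ * c₂, ζ * c₂⁻¹, ζ * c₃, ζ * c₃⁻¹,
      ζ ^ 2 * c₁, ζ ^ 2 * c₁⁻¹, ζ ^ 2 * c₂, ζ ^ 2 * c₂⁻¹, ζ ^ 2 * c₃, ζ ^ 2 * c₃⁻¹] :
      List F).Nodup := by
  have hζ3 : ζ ^ 3 = 1 := by linear_combination (ζ - 1) * hζ
  have hζ1 : ζ ≠ 1 := by
    rintro rfl
    have h2 : (2 : F) = 0 := CharTwo.two_eq_zero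
    exact one_ne_zero (by linear_combination hζ - h2 : (1 : F) = 0)
  have hprim : IsPrimitiveRoot ζ 3 := (IsPrimitiveRoot.iff_orderOf).2
    (orderOf_eq_prime hζ3 hζ1)
  have hζ0 : ζ ≠ 0 := hprim.ne_zero (by norm_num)
  have hy0 : y ≠ 0 := by
    rintro rfl
    rw [orderOf_zero] at hy
    omega
  obtain ⟨z, hz⟩ : ∃ z, z = y ^ 2 := ⟨_, rfl⟩
  have hz0 : z ≠ 0 := hz ▸ pow_ne_zero 2 hy0
  have hzo : 14 < orderOf z := by
    have hodd : Nat.Coprime (orderOf y) 2 := by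
      have hm : m ≠ 0 := by
        rintro rfl
        omega
      have h2q : 2 ∣ q := hq ▸ dvd_pow_self 2 hm
      rw [hy, Nat.coprime_two_right, Nat.odd_iff]
      omega
    rw [hz, hodd.orderOf_pow, hy]
    omega
  have hinj : ∀ a b : ℤ, |a - b| ≤ 14 → z ^ a = z ^ b → a = b :=
    fun a b => zpow_inj_of_lt_orderOf hz0 hzo
  have hc₁' : c₁ ^ 3 = z ^ (4 : ℤ) := by rw [hc₁, hz]; norm_cast; ring
  have hc₂' : c₂ ^ 3 = z ^ (5 : ℤ) := by rw [hc₂, hz]; norm_cast; ring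
  have hc₃' : c₃ ^ 3 = z ^ (1 : ℤ) := by rw [hc₃, hz, zpow_one]
  have hy4 : y ^ 4 = z ^ 2 := by rw [hz]; ring
  have hy6 : y ^ 6 = z ^ 3 := by rw [hz]; ring
  rw [hy4, hy6, ← hz]
  let K : List ℤ := [1, -1, 2, -2, 3, -3]
  let E : List ℤ := [4, -4, 5, -5, 1, -1]
  let C : List F := [c₁, c₁⁻¹, c₂, c₂⁻¹, c₃, c₃⁻¹]
  have hC : C.map (· ^ 3) = E.map (z ^ ·) := by
    simp only [C, E, List.map_cons, List.map_nil, inv_pow, hc₁', hc₂', hc₃', zpow_neg]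
  have hCE : ∀ d ∈ C, ∃ a ∈ E, d ^ 3 = z ^ a := by
    intro d hd
    have := List.mem_map_of_mem (f := (· ^ 3)) hd
    rw [hC, List.mem_map] at this
    obtain ⟨a, ha, h⟩ := this
    exact ⟨a, ha, h.symm⟩
  have hC0 : ∀ d ∈ C, d ≠ 0 := by
    rintro d hd rfl
    obtain ⟨a, -, h⟩ := hCE 0 hd
    exact zpow_ne_zero a hz0 (by rw [← h, zero_pow (by norm_num)])
  have hKcube : ∀ x ∈ [ζ, ζ ^ 2] ++ K.map (z ^ ·), ∃ k ∈ 0 :: K, x ^ 3 = z ^ (3 * k) := by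
    intro x hx
    simp only [List.mem_append, List.mem_cons, List.not_mem_nil, or_false, List.mem_map] at hx
    rcases hx with (rfl | rfl) | ⟨k, hk, rfl⟩
    · exact ⟨0, by simp, by simpa using hζ3⟩
    · exact ⟨0, by simp, by rw [← pow_mul, mul_comm 2 3, pow_mul, hζ3]; simp⟩
    · exact ⟨k, List.mem_cons_of_mem _ hk, by rw [mul_comm, zpow_mul]; norm_cast⟩
  have hCcube : ∀ x ∈ C.flatMap (fun d => [d, ζ * d, ζ ^ 2 * d]), ∃ a ∈ E, x ^ 3 = z ^ a := by
    intro x hx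
    obtain ⟨d, hd, hx⟩ := List.mem_flatMap.1 hx
    obtain ⟨a, ha, h⟩ := hCE d hd
    refine ⟨a, ha, h ▸ ?_⟩
    simp only [List.mem_cons, List.not_mem_nil, or_false] at hx
    rcases hx with rfl | rfl | rfl
    · rfl
    · linear_combination d ^ 3 * hζ3
    · linear_combination d ^ 3 * (ζ ^ 3 + 1) * hζ3
  have hnodup : ([ζ, ζ ^ 2] ++ K.map (z ^ ·) ++
      C.flatMap (fun d => [d, ζ * d, ζ ^ 2 * d])).Nodup := by
    refine List.Nodup.append (List.Nodup.append ?_ ?_ ?_) ?_ ?_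
    · have : ζ ≠ ζ ^ 2 := fun h => hζ1 (mul_left_cancel₀ hζ0 (by linear_combination -h))
      simpa using this
    · exact nodup_map_zpow_of_lt_orderOf hz0 hzo (by decide) (by decide)
    · intro x hx hx'
      obtain ⟨k, hk, rfl⟩ := List.mem_map.1 hx'
      have hone : (z ^ k) ^ 3 = 1 := by
        simp only [List.mem_cons, List.not_mem_nil, or_false] at hx
        rcases hx with hx | hx <;> rw [hx]
        · exact hζ3
        · linear_combination (ζ ^ 3 + 1) * hζ3
      have hbound : ∀ k ∈ K, |3 * k - 0| ≤ 14 ∧ 3 * k ≠ 0 := by decide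
      refine (hbound k hk).2 (hinj _ _ (hbound k hk).1 ?_)
      rw [zpow_zero, ← hone, mul_comm, zpow_mul]
      norm_cast
    · refine nodup_flatMap_cube_roots hprim hC0 ?_
      rw [hC]
      exact nodup_map_zpow_of_lt_orderOf hz0 hzo (by decide) (by decide)
    · intro x hx hx'
      obtain ⟨k, hk, h⟩ := hKcube x hx
      obtain ⟨a, ha, h'⟩ := hCcube x hx'
      have hbound : ∀ k ∈ 0 :: K, ∀ a ∈ E, |3 * k - a| ≤ 14 ∧ 3 * k ≠ a := by decide
      exact (hbound k hk a ha).2 (hinj _ _ (hbound k hk a ha).1 (h.symm.trans h'))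
  refine (List.Perm.nodup_iff ?_).1 hnodup
  classical
  rw [List.perm_iff_count]
  intro x
  have hz2 : z ^ (2 : ℤ) = z ^ 2 := by norm_cast
  have hz3 : z ^ (3 : ℤ) = z ^ 3 := by norm_cast
  simp only [K, C, List.map_cons, List.map_nil, List.flatMap_cons, List.flatMap_nil,
    List.cons_append, List.nil_append, List.append_nil, List.count_cons, List.count_nil,
    zpow_neg, zpow_one, hz2, hz3]
  ring
end
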